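/- arXiv:1312.0464 — 11 statements merged into one kernel-verified Lean document; each statement's English description precedes it below -/
import Mathlib

section
/- Let f be a locally square-integrable function on ℝ and let g be a 2π-periodic function that is square integrable on a period. Suppose that M(f) := Σ_{k∈ℤ} ‖𝟙_{I_k} f‖_{L²} < ∞, where 𝟙_{I_k} is the indicator function of the interval I_k = [2πk, 2π(k+1)]. Then ∫_ℝ f(x)·conj(g(x)) dx = Σ_{n∈ℤ} f̂(n)·conj(C_n(g)), where f̂(ω) = ∫_ℝ f(t)e^{-iωt} dt is the Fourier transform of f and C_n(g) = (1/2π)∫₀^{2π} g(t)e^{-int} dt are the exponential Fourier coefficients of g; moreover both the integral on the left and the sum on the right converge. -/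
open MeasureTheory Real Filter

section Periodization

open Set AddCircle ComplexConjugate

variable {T : ℝ}

lemma memLp_fourier (n : ℤ) :
    MemLp (fun x : ℝ => fourier n (x : AddCircle T)) 2 (volume.restrict (Ioc 0 T)) := by
  refine MemLp.of_bound (Continuous.aestronglyMeasurable (by fun_prop)) 1 (ae_of_all _ fun x => ?_)
  rw [fourier_apply, Circle.norm_coe]

lemma measurePreserving_add_period (k : ℤ) :
    MeasurePreserving (fun x : ℝ => x + T * k) (volume.restrict (Ioc 0 T))
      (volume.restrict (Ioc (T * k) (T * (k + 1)))) := by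
  convert (measurePreserving_add_right volume (T * k)).restrict_preimage
    (measurableSet_Ioc (a := T * (k : ℝ)) (b := T * (k + 1))) using 2
  rw [preimage_add_const_Ioc]
  ring_nf

lemma setIntegral_Ioc_period {E : Type*} [NormedAddCommGroup E] [NormedSpace ℝ E]
    (F : ℝ → E) (k : ℤ) :
    ∫ x in Ioc (T * k) (T * (k + 1)), F x = ∫ x in Ioc 0 T, F (x + T * k) :=
  ((measurePreserving_add_period k).integral_comp (measurableEmbedding_addRight _) F).symm

lemma pairwise_disjoint_Ioc_period :
    Pairwise (Function.onFun Disjoint fun k : ℤ => Ioc (T * k) (T * (k + 1))) := by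
  simpa [mul_comm] using pairwise_disjoint_Ioc_zsmul T

variable [hT : Fact (0 < T)]

/-- The class in `L²` of the circle of a function that is square integrable on `(0, T]`. -/
noncomputable def circleL2 (u : ℝ → ℂ) (hu : MemLp u 2 (volume.restrict (Ioc 0 T))) :
    Lp ℂ 2 (@haarAddCircle T hT) :=
  MemLp.toLp (liftIoc T 0 u)
    (MemLp.memLp_liftIoc (t := 0) (by rwa [zero_add])).haarAddCircle

lemma inner_circleL2 {u v : ℝ → ℂ} (hu : MemLp u 2 (volume.restrict (Ioc 0 T)))
    (hv : MemLp v 2 (volume.restrict (Ioc 0 T))) :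
    inner ℂ (circleL2 u hu) (circleL2 v hv) =
      ((T⁻¹ : ℝ) : ℂ) * ∫ x in Ioc 0 T, v x * conj (u x) := by
  rw [L2.inner_def]
  have h : ∫ a, inner ℂ (circleL2 u hu a) (circleL2 v hv a) ∂haarAddCircle =
      ∫ a, liftIoc T 0 (fun x => v x * conj (u x)) a ∂(@haarAddCircle T hT) := by
    refine integral_congr_ae ?_
    filter_upwards [MemLp.coeFn_toLp (MemLp.memLp_liftIoc (T := T) (t := 0) (f := u)
        (p := 2) (by rwa [zero_add])).haarAddCircle,
      MemLp.coeFn_toLp (MemLp.memLp_liftIoc (T := T) (t := 0) (f := v)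
        (p := 2) (by rwa [zero_add])).haarAddCircle] with a h₁ h₂
    simp only [circleL2, h₁, h₂, RCLike.inner_apply]
    rfl
  rw [h, integral_haarAddCircle, integral_liftIoc_eq_intervalIntegral, zero_add,
    intervalIntegral.integral_of_le hT.out.le, Complex.real_smul]

lemma norm_circleL2 {u : ℝ → ℂ} (hu : MemLp u 2 (volume.restrict (Ioc 0 T))) :
    ‖circleL2 u hu‖ = √T⁻¹ * (∫ x in Ioc 0 T, ‖u x‖ ^ 2) ^ ((1 : ℝ) / 2) := by
  have h : ‖circleL2 u hu‖ ^ 2 = T⁻¹ * ∫ x in Ioc 0 T, ‖u x‖ ^ 2 := by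
    rw [norm_sq_eq_re_inner (𝕜 := ℂ), inner_circleL2]
    simp_rw [RCLike.mul_conj]
    norm_cast
    simp
  rw [← Real.sqrt_eq_rpow, ← Real.sqrt_mul (inv_nonneg.2 hT.out.le), ← h,
    Real.sqrt_sq (norm_nonneg _)]

lemma circleL2_fourier (n : ℤ) : circleL2 _ (memLp_fourier n) = @fourierLp T hT 2 _ n := by
  refine Lp.ext ((MemLp.coeFn_toLp _).trans (EventuallyEq.trans ?_ (coeFn_fourierLp 2 n).symm))
  refine EventuallyEq.of_eq (funext fun a => ?_)
  exact congrArg (fourier n) ((equivIoc T 0).symm_apply_apply a)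

lemma iUnion_Ioc_period : ⋃ k : ℤ, Ioc (T * k) (T * (k + 1)) = univ := by
  simpa [mul_comm] using iUnion_Ioc_zsmul hT.out

/-- Pairing with a periodic function factors through the periodization of `f` in `L²`. -/
lemma integrable_and_integral_mul_conj_eq_inner {f h : ℝ → ℂ}
    (hf : ∀ k : ℤ, MemLp (fun x => f (x + T * k)) 2 (volume.restrict (Ioc 0 T)))
    (hs : Summable fun k : ℤ => ‖circleL2 _ (hf k)‖)
    (hp : Function.Periodic h T)
    (hh : MemLp h 2 (volume.restrict (Ioc 0 T))) :
    Integrable (fun x => f x * conj (h x)) ∧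
    ∫ x, f x * conj (h x) =
      T * inner ℂ (circleL2 h hh) (∑' k, circleL2 _ (hf k)) := by
  have hT0 : (T : ℂ) ≠ 0 := by exact_mod_cast hT.out.ne'
  have hper (k : ℤ) (x : ℝ) : h (x + T * k) = h x := by
    rw [mul_comm]; exact hp.int_mul k x
  have hprod (k : ℤ) :
      Integrable (fun x => f (x + T * k) * conj (h x)) (volume.restrict (Ioc 0 T)) :=
    (hf k).integrable_mul hh.star
  have hon (k : ℤ) : IntegrableOn (fun x => f x * conj (h x)) (Ioc (T * k) (T * (k + 1))) := by
    rw [IntegrableOn, ← (measurePreserving_add_period k).integrable_comp_emb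
      (measurableEmbedding_addRight _)]
    simpa only [Function.comp_def, hper] using hprod k
  have hbound (k : ℤ) : ∫ x in Ioc (T * k) (T * (k + 1)), ‖f x * conj (h x)‖ ≤
      T * ‖circleL2 h hh‖ * ‖circleL2 _ (hf k)‖ := by
    rw [setIntegral_Ioc_period, norm_circleL2, norm_circleL2]
    simp only [norm_mul, RCLike.norm_conj, hper]
    have := integral_mul_norm_le_Lp_mul_Lq (μ := volume.restrict (Ioc 0 T))
      (f := fun x => f (x + T * k)) (g := h) Real.HolderConjugate.two_two
      (by simpa using hf k) (by simpa using hh)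
    refine this.trans_eq ?_
    simp only [Real.rpow_two]
    have e : T * (√T⁻¹ * √T⁻¹) = 1 := by
      rw [Real.mul_self_sqrt (inv_nonneg.2 hT.out.le), mul_inv_cancel₀ hT.out.ne']
    linear_combination (-(∫ x in Ioc 0 T, ‖f (x + T * k)‖ ^ 2) ^ ((1 : ℝ) / 2) *
      (∫ x in Ioc 0 T, ‖h x‖ ^ 2) ^ ((1 : ℝ) / 2)) * e
  have hint : IntegrableOn (fun x => f x * conj (h x)) (⋃ k : ℤ, Ioc (T * k) (T * (k + 1))) :=
    integrableOn_iUnion_of_summable_integral_norm hon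
      (.of_nonneg_of_le (fun k => integral_nonneg fun x => norm_nonneg _) hbound (hs.mul_left _))
  have hsum := hasSum_integral_iUnion (fun k : ℤ => measurableSet_Ioc)
    pairwise_disjoint_Ioc_period hint
  rw [iUnion_Ioc_period] at hint hsum
  rw [integrableOn_univ] at hint
  rw [setIntegral_univ] at hsum
  refine ⟨hint, hsum.unique ?_⟩
  refine ((hs.of_norm.hasSum.mapL (innerSL ℂ (circleL2 h hh))).mul_left (T : ℂ)).congr_fun
    fun k => ?_
  rw [innerSL_apply_apply, inner_circleL2, setIntegral_Ioc_period]
  simp only [hper]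
  push_cast
  rw [mul_inv_cancel_left₀ hT0]

/-- The mixed Parseval–Plancherel formula for functions of arbitrary period `T`. -/
lemma hasSum_integral_mul_conj_fourier {f g : ℝ → ℂ}
    (hf : ∀ k : ℤ, MemLp (fun x => f (x + T * k)) 2 (volume.restrict (Ioc 0 T)))
    (hs : Summable fun k : ℤ => ‖circleL2 _ (hf k)‖)
    (hp : Function.Periodic g T)
    (hg : MemLp g 2 (volume.restrict (Ioc 0 T))) :
    HasSum (fun n : ℤ => (∫ x, f x * conj (fourier n (x : AddCircle T))) *
        conj (((T⁻¹ : ℝ) : ℂ) * ∫ x in Ioc 0 T, g x * conj (fourier n (x : AddCircle T))))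
      (∫ x, f x * conj (g x)) := by
  rw [(integrable_and_integral_mul_conj_eq_inner hf hs hp hg).2]
  refine (((@fourierBasis T hT).hasSum_inner_mul_inner (circleL2 g hg)
    (∑' k, circleL2 _ (hf k))).mul_left (T : ℂ)).congr_fun fun n => ?_
  have hn : Function.Periodic (fun x : ℝ => fourier n (x : AddCircle T)) T := fun x => by
    simp only [coe_add_period]
  rw [(integrable_and_integral_mul_conj_eq_inner hf hs hn (memLp_fourier n)).2,
    ← inner_circleL2 (memLp_fourier n) hg, inner_conj_symm, coe_fourierBasis, circleL2_fourier]
  ring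

end Periodization

/-- **The mixed Parseval–Plancherel formula.**
If `f` is locally square integrable on `ℝ` with
`M(f) = ∑_{k ∈ ℤ} ‖𝟙_{[2πk, 2π(k+1)]} f‖_{L²} < ∞`, and `g` is `2π`-periodic and square
integrable on a period, then `fḡ` is integrable on `ℝ` and
`∫_ℝ f(x) conj (g x) dx = ∑_{n ∈ ℤ} f̂(n) conj (Cₙ(g))`. -/
theorem mixed_parseval_plancherel (f g : ℝ → ℂ)
    (hf_meas : AEStronglyMeasurable f volume)
    (hf_loc : ∀ k : ℤ, IntegrableOn (fun x => ‖f x‖ ^ 2)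
      (Set.Icc (2 * π * (k : ℝ)) (2 * π * ((k : ℝ) + 1))))
    (hM : Summable fun k : ℤ =>
      (∫ x in Set.Icc (2 * π * (k : ℝ)) (2 * π * ((k : ℝ) + 1)), ‖f x‖ ^ 2) ^ ((1 : ℝ) / 2))
    (hg_meas : AEStronglyMeasurable g volume)
    (hg_per : ∀ x : ℝ, g (x + 2 * π) = g x)
    (hg_sq : IntegrableOn (fun x => ‖g x‖ ^ 2) (Set.Icc (0 : ℝ) (2 * π))) :
    Integrable (fun x => f x * (starRingEnd ℂ) (g x)) ∧
    HasSum
      (fun n : ℤ =>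
        (∫ t : ℝ, f t * Complex.exp (-Complex.I * (n : ℂ) * (t : ℂ))) *
          (starRingEnd ℂ)
            ((((2 * π)⁻¹ : ℝ) : ℂ) *
              ∫ t in (0 : ℝ)..(2 * π), g t * Complex.exp (-Complex.I * (n : ℂ) * (t : ℂ))))
      (∫ x : ℝ, f x * (starRingEnd ℂ) (g x)) := by
  have hT : Fact (0 < 2 * π) := ⟨two_pi_pos⟩
  have hg : MemLp g 2 (volume.restrict (Set.Ioc 0 (2 * π))) :=
    (memLp_two_iff_integrable_sq_norm hg_meas.restrict).2 (hg_sq.mono_set Set.Ioc_subset_Icc_self)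
  have hf (k : ℤ) :
      MemLp (fun x => f (x + 2 * π * k)) 2 (volume.restrict (Set.Ioc 0 (2 * π))) :=
    ((memLp_two_iff_integrable_sq_norm hf_meas.restrict).2
      ((hf_loc k).mono_set Set.Ioc_subset_Icc_self)).comp_measurePreserving
      (measurePreserving_add_period k)
  have hs : Summable fun k : ℤ => ‖circleL2 _ (hf k)‖ := by
    refine (hM.mul_left √(2 * π)⁻¹).congr fun k => ?_
    rw [norm_circleL2, integral_Icc_eq_integral_Ioc, setIntegral_Ioc_period]
  have hexp (n : ℤ) (x : ℝ) : (starRingEnd ℂ) (fourier n (x : AddCircle (2 * π))) =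
      Complex.exp (-Complex.I * n * x) := by
    rw [← fourier_neg, fourier_coe_apply]
    congr 1
    have : (π : ℂ) ≠ 0 := by exact_mod_cast pi_ne_zero
    push_cast
    field_simp
  refine ⟨(integrable_and_integral_mul_conj_eq_inner hf hs hg_per hg).1, ?_⟩
  simpa only [hexp, intervalIntegral.integral_of_le two_pi_pos.le] using
    hasSum_integral_mul_conj_fourier hf hs hg_per hg
end

section
/- Let T > 0, let f be a locally square-integrable function on ℝ, and let g be a T-periodic function that is square integrable on a period. Suppose that M_T(f) := Σ_{k∈ℤ} ‖𝟙_{[kT,(k+1)T]} f‖_{L²} < ∞. Then ∫_ℝ f(x)·conj(g(x)) dx = Σ_{n∈ℤ} f̂(2πn/T)·conj(C_n(g)), where f̂(ω) = ∫_ℝ f(t)e^{-iωt} dt and C_n(g) = (1/T)∫₀^T g(x)e^{-2πinx/T} dx. -/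
open MeasureTheory Real Filter

section CircleLift

open AddCircle Set

variable {T : ℝ}

/-- The class in `L²` of the circle of a function that is square integrable on `(0, T]`. -/
noncomputable def circleLift [hT : Fact (0 < T)] (u : ℝ → ℂ)
    (hu : MemLp u 2 (volume.restrict (Ioc 0 (0 + T)))) : Lp ℂ 2 (@haarAddCircle T hT) :=
  hu.memLp_liftIoc.haarAddCircle.toLp

theorem inner_circleLift [hT : Fact (0 < T)] {u v : ℝ → ℂ}
    (hu : MemLp u 2 (volume.restrict (Ioc 0 (0 + T))))
    (hv : MemLp v 2 (volume.restrict (Ioc 0 (0 + T)))) :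
    inner ℂ (circleLift u hu) (circleLift v hv) =
      (T⁻¹ : ℂ) * ∫ x in (0 : ℝ)..T, v x * (starRingEnd ℂ) (u x) := by
  have h : inner ℂ (circleLift u hu) (circleLift v hv) =
      ∫ y, liftIoc T 0 (fun x => v x * (starRingEnd ℂ) (u x)) y ∂haarAddCircle := by
    rw [L2.inner_def]
    apply integral_congr_ae
    filter_upwards [hu.memLp_liftIoc.haarAddCircle.coeFn_toLp,
      hv.memLp_liftIoc.haarAddCircle.coeFn_toLp] with y hy hy'
    rw [circleLift, circleLift, hy, hy', RCLike.inner_apply]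
    rfl
  rw [h, integral_haarAddCircle, integral_liftIoc_eq_intervalIntegral, zero_add, Complex.real_smul,
    Complex.ofReal_inv]

theorem norm_circleLift [hT : Fact (0 < T)] {u : ℝ → ℂ}
    (hu : MemLp u 2 (volume.restrict (Ioc 0 (0 + T)))) :
    ‖circleLift u hu‖ = √T⁻¹ * √(∫ x in (0 : ℝ)..T, ‖u x‖ ^ 2) := by
  have h := inner_circleLift hu hu
  simp_rw [Complex.mul_conj, Complex.normSq_eq_norm_sq] at h
  rw [intervalIntegral.integral_ofReal, inner_self_eq_norm_sq_to_K] at h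
  have h' : ‖circleLift u hu‖ ^ 2 = T⁻¹ * ∫ x in (0 : ℝ)..T, ‖u x‖ ^ 2 := by
    apply Complex.ofReal_injective
    push_cast
    exact h
  rw [← Real.sqrt_mul (inv_nonneg.2 hT.out.le), ← h', Real.sqrt_sq (norm_nonneg _)]

theorem memLp_exp_restrict (ω : ℝ) :
    MemLp (fun x : ℝ => Complex.exp (Complex.I * (ω : ℂ) * (x : ℂ))) 2
      (volume.restrict (Ioc 0 (0 + T))) := by
  refine MemLp.of_bound (by fun_prop) 1 (ae_of_all _ fun x => ?_)
  rw [Complex.norm_exp]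
  simp

theorem circleLift_exp [hT : Fact (0 < T)] (n : ℤ) :
    circleLift _ (memLp_exp_restrict (T := T) (2 * π * (n : ℝ) / T)) = fourierLp 2 n := by
  apply Lp.ext
  refine (MemLp.coeFn_toLp _).trans (EventuallyEq.trans ?_ (coeFn_fourierLp 2 n).symm)
  refine ae_of_all _ fun y => ?_
  obtain ⟨x, hx, rfl⟩ : ∃ x ∈ Ioc (0 : ℝ) (0 + T), (x : AddCircle T) = y :=
    ⟨_, (equivIoc T 0 y).2, (equivIoc T 0).symm_apply_apply y⟩
  rw [liftIoc_coe_apply hx, fourier_coe_apply]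
  congr 1
  push_cast
  ring

theorem conj_exp_I_mul (ω x : ℝ) :
    (starRingEnd ℂ) (Complex.exp (Complex.I * (ω : ℂ) * (x : ℂ))) =
      Complex.exp (-Complex.I * (ω : ℂ) * (x : ℂ)) := by
  simp [← Complex.exp_conj]

theorem Function.Periodic.exp_two_pi_mul_div (hT : T ≠ 0) (n : ℤ) :
    Function.Periodic
      (fun x : ℝ => Complex.exp (Complex.I * ((2 * π * (n : ℝ) / T : ℝ) : ℂ) * (x : ℂ))) T := by
  intro x
  have hT' : (T : ℂ) ≠ 0 := mod_cast hT
  refine Complex.exp_eq_exp_iff_exists_int.2 ⟨n, ?_⟩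
  push_cast
  field_simp

end CircleLift

section Tiling

open AddCircle Set

variable {T : ℝ}

theorem measurePreserving_add_tile (k : ℤ) :
    MeasurePreserving (fun x : ℝ => x + k * T) (volume.restrict (Ioc 0 (0 + T)))
      (volume.restrict (Ioc (k * T) ((k + 1) * T))) := by
  convert (measurePreserving_add_right volume ((k : ℝ) * T)).restrict_preimage
    (measurableSet_Ioc (a := (k : ℝ) * T) (b := (k + 1) * T)) using 2
  simp only [preimage_add_const_Ioc]
  congr 1 <;> ring

theorem setIntegral_tile {E : Type*} [NormedAddCommGroup E] [NormedSpace ℝ E] (hT : 0 < T)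
    (φ : ℝ → E) (k : ℤ) :
    ∫ x in Ioc ((k : ℝ) * T) ((k + 1) * T), φ x = ∫ x in (0 : ℝ)..T, φ (x + k * T) := by
  rw [intervalIntegral.integral_comp_add_right, intervalIntegral.integral_of_le (by linarith)]
  congr 3 <;> ring

theorem memLp_tile {f : ℝ → ℂ} (hf_meas : AEStronglyMeasurable f volume)
    (hf_loc : ∀ k : ℤ, IntegrableOn (fun x => ‖f x‖ ^ 2)
      (Icc ((k : ℝ) * T) (((k : ℝ) + 1) * T))) (k : ℤ) :
    MemLp (fun x => f (x + k * T)) 2 (volume.restrict (Ioc 0 (0 + T))) :=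
  ((memLp_two_iff_integrable_sq_norm hf_meas.restrict).2
    ((hf_loc k).mono_set Ioc_subset_Icc_self)).comp_measurePreserving (measurePreserving_add_tile k)

theorem hasSum_setIntegral_tile {φ : ℝ → ℂ} (hT : 0 < T) (hφ : Integrable φ) :
    HasSum (fun k : ℤ => ∫ x in Ioc ((k : ℝ) * T) ((k + 1) * T), φ x) (∫ x, φ x) := by
  have hU := iUnion_Ioc_zsmul hT
  have hd := pairwise_disjoint_Ioc_zsmul T
  simp only [zsmul_eq_mul, Int.cast_add, Int.cast_one] at hU hd
  have h := hasSum_integral_iUnion (f := φ) (fun _ => measurableSet_Ioc) hd hφ.integrableOn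
  rwa [hU, setIntegral_univ] at h

theorem integrable_of_summable_tile {φ : ℝ → ℂ} (hT : 0 < T)
    (hφ : ∀ k : ℤ, IntegrableOn φ (Ioc ((k : ℝ) * T) ((k + 1) * T)))
    (hs : Summable fun k : ℤ => ∫ x in Ioc ((k : ℝ) * T) ((k + 1) * T), ‖φ x‖) :
    Integrable φ := by
  have hU := iUnion_Ioc_zsmul hT
  simp only [zsmul_eq_mul, Int.cast_add, Int.cast_one] at hU
  rw [← integrableOn_univ, ← hU]
  exact integrableOn_iUnion_of_summable_integral_norm hφ hs

theorem summable_circleLift_tile [hT : Fact (0 < T)] {f : ℝ → ℂ}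
    (hf : ∀ k : ℤ, MemLp (fun x => f (x + k * T)) 2 (volume.restrict (Ioc 0 (0 + T))))
    (hM : Summable fun k : ℤ =>
      (∫ x in Icc ((k : ℝ) * T) (((k : ℝ) + 1) * T), ‖f x‖ ^ 2) ^ ((1 : ℝ) / 2)) :
    Summable fun k : ℤ => ‖circleLift _ (hf k)‖ := by
  refine (hM.mul_left √T⁻¹).congr fun k => ?_
  rw [norm_circleLift, integral_Icc_eq_integral_Ioc, setIntegral_tile hT.out, ← Real.sqrt_eq_rpow]

/-- Unfolding: pairing `f` with a periodic `h` over the line is, up to the factor `T`, pairing the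
periodization of `f` with `h` on the circle. -/
theorem integrable_and_integral_mul_conj_periodic [hT : Fact (0 < T)] {f h : ℝ → ℂ}
    (hf : ∀ k : ℤ, MemLp (fun x => f (x + k * T)) 2 (volume.restrict (Ioc 0 (0 + T))))
    (hs : Summable fun k : ℤ => ‖circleLift _ (hf k)‖)
    (hh : MemLp h 2 (volume.restrict (Ioc 0 (0 + T)))) (hper : Function.Periodic h T) :
    Integrable (fun x => f x * (starRingEnd ℂ) (h x)) ∧
      ∫ x, f x * (starRingEnd ℂ) (h x) =
        T * inner ℂ (circleLift h hh) (∑' k : ℤ, circleLift _ (hf k)) := by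
  have hT0 := hT.out
  have hTc : (T : ℂ) ≠ 0 := mod_cast hT0.ne'
  have hshift (k : ℤ) (x : ℝ) : h (x + k * T) = h x := hper.int_mul k x
  have hnorm {u : ℝ → ℂ} (hu : MemLp u 2 (volume.restrict (Ioc 0 (0 + T)))) :
      √(∫ x in (0 : ℝ)..T, ‖u x‖ ^ 2) = √T * ‖circleLift u hu‖ := by
    rw [norm_circleLift, ← mul_assoc, ← Real.sqrt_mul hT0.le, mul_inv_cancel₀ hT0.ne',
      Real.sqrt_one, one_mul]
  have hint : Integrable (fun x => f x * (starRingEnd ℂ) (h x)) := by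
    refine integrable_of_summable_tile hT0 (fun k => ?_) ?_
    · refine ((measurePreserving_add_tile k).integrable_comp_emb
        (MeasurableEquiv.addRight ((k : ℝ) * T)).measurableEmbedding).1 ?_
      simp only [Function.comp_def, hshift]
      exact (hf k).integrable_mul hh.star
    · refine Summable.of_nonneg_of_le (fun k => integral_nonneg fun x => norm_nonneg _)
        (fun k => ?_) (hs.mul_left (√T * (√T * ‖circleLift h hh‖)))
      rw [setIntegral_tile hT0]
      simp only [hshift, norm_mul, RCLike.norm_conj]
      have hHol := integral_mul_norm_le_Lp_mul_Lq (p := 2) (q := 2)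
        (μ := volume.restrict (Ioc 0 (0 + T))) Real.HolderConjugate.two_two
        (f := fun x => f (x + k * T)) (g := h) (by simpa using hf k) (by simpa using hh)
      simp only [Real.rpow_two, ← Real.sqrt_eq_rpow, zero_add,
        ← intervalIntegral.integral_of_le hT0.le] at hHol
      rw [hnorm (hf k), hnorm hh] at hHol
      linarith
  refine ⟨hint, (hasSum_setIntegral_tile hT0 hint).unique ?_⟩
  have hsum := ((hs.of_norm.hasSum.mapL (innerSL ℂ (circleLift h hh))).mul_left (T : ℂ))
  convert! hsum using 2 with k
  rw [innerSL_apply_apply, inner_circleLift, mul_inv_cancel_left₀ hTc, setIntegral_tile hT0]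
  simp only [hshift]

end Tiling

/-- **Corollary of the mixed Parseval–Plancherel formula** for a `T`-periodic `g`:
`∫_ℝ f(x) conj (g x) dx = ∑_{n ∈ ℤ} f̂(2πn/T) conj (Cₙ(g))`. -/
theorem mixed_parseval_plancherel_T (T : ℝ) (hT : 0 < T) (f g : ℝ → ℂ)
    (hf_meas : AEStronglyMeasurable f volume)
    (hf_loc : ∀ k : ℤ, IntegrableOn (fun x => ‖f x‖ ^ 2)
      (Set.Icc ((k : ℝ) * T) (((k : ℝ) + 1) * T)))
    (hM : Summable fun k : ℤ =>
      (∫ x in Set.Icc ((k : ℝ) * T) (((k : ℝ) + 1) * T), ‖f x‖ ^ 2) ^ ((1 : ℝ) / 2))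
    (hg_meas : AEStronglyMeasurable g volume)
    (hg_per : ∀ x : ℝ, g (x + T) = g x)
    (hg_sq : IntegrableOn (fun x => ‖g x‖ ^ 2) (Set.Icc (0 : ℝ) T)) :
    Integrable (fun x => f x * (starRingEnd ℂ) (g x)) ∧
    HasSum
      (fun n : ℤ =>
        (∫ t : ℝ, f t * Complex.exp (-Complex.I * ((2 * π * (n : ℝ) / T : ℝ) : ℂ) * (t : ℂ))) *
          (starRingEnd ℂ)
            (((T⁻¹ : ℝ) : ℂ) *
              ∫ x in (0 : ℝ)..T,
                g x * Complex.exp (-Complex.I * ((2 * π * (n : ℝ) / T : ℝ) : ℂ) * (x : ℂ))))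
      (∫ x : ℝ, f x * (starRingEnd ℂ) (g x)) := by
  have : Fact (0 < T) := ⟨hT⟩
  have hTc : (T : ℂ) ≠ 0 := mod_cast hT.ne'
  have hf := memLp_tile hf_meas hf_loc
  have hs := summable_circleLift_tile hf hM
  have hg : MemLp g 2 (volume.restrict (Set.Ioc 0 (0 + T))) := by
    refine (memLp_two_iff_integrable_sq_norm hg_meas.restrict).2 ?_
    rw [zero_add]
    exact hg_sq.mono_set Set.Ioc_subset_Icc_self
  obtain ⟨hint, hval⟩ := integrable_and_integral_mul_conj_periodic hf hs hg hg_per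
  refine ⟨hint, ?_⟩
  rw [hval]
  convert! (fourierBasis.hasSum_inner_mul_inner (circleLift g hg)
    (∑' k : ℤ, circleLift _ (hf k))).mul_left (T : ℂ) using 2 with n
  have hexp := (integrable_and_integral_mul_conj_periodic hf hs (memLp_exp_restrict _)
    (Function.Periodic.exp_two_pi_mul_div hT.ne' n)).2
  have hcoeff := inner_circleLift (memLp_exp_restrict (T := T) (2 * π * (n : ℝ) / T)) hg
  rw [circleLift_exp] at hexp hcoeff
  simp only [conj_exp_I_mul] at hexp hcoeff
  rw [hexp, Complex.ofReal_inv, ← hcoeff, inner_conj_symm, coe_fourierBasis]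
  ring
end

section
/- Let a > 0. The 2π-periodic function g(x) = 1/(cosh a + cos x) has exponential Fourier coefficients C_n(g) = (-1)^n e^{-|n|a}/sinh a for all n ∈ ℤ; equivalently, for all real x, 1/(cosh a + cos x) = (1/sinh a)·Σ_{n∈ℤ} (-1)^n e^{-|n|a} e^{inx}. -/
open MeasureTheory Real Filter

/-- The two-sided geometric series with ratios `q` on the nonnegative and `q'` on the negative
indices. -/
lemma hasSum_int_of_geometric {f : ℤ → ℂ} {q q' : ℂ} (hq : ‖q‖ < 1) (hq' : ‖q'‖ < 1)
    (hf : ∀ n : ℕ, f n = q ^ n) (hf' : ∀ n : ℕ, f (-(n + 1 : ℤ)) = q' ^ (n + 1)) :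
    HasSum f ((1 - q)⁻¹ + q' * (1 - q')⁻¹) := by
  refine HasSum.of_nat_of_neg_add_one ?_ ?_
  · simpa only [hf] using hasSum_geometric_of_norm_lt_one hq
  · simpa only [hf', pow_succ'] using (hasSum_geometric_of_norm_lt_one hq').mul_left q'

/-- Orthogonality of the exponentials on a period. -/
lemma integral_exp_I_mul_int (k : ℤ) :
    ∫ t in (0 : ℝ)..(2 * π), Complex.exp (Complex.I * (k : ℂ) * (t : ℂ)) =
      if k = 0 then ((2 * π : ℝ) : ℂ) else 0 := by
  split_ifs with hk
  · simp [hk]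
  · rw [integral_exp_mul_complex (mul_ne_zero Complex.I_ne_zero (Int.cast_ne_zero.mpr hk))]
    have h : Complex.I * (k : ℂ) * ((2 * π : ℝ) : ℂ) = k * (2 * π * Complex.I) := by
      push_cast; ring
    rw [h, Complex.exp_int_mul_two_pi_mul_I]
    simp

lemma summable_exp_neg_abs_mul {a : ℝ} (ha : 0 < a) :
    Summable fun n : ℤ => Real.exp (-|(n : ℝ)| * a) := by
  have h : Summable fun n : ℕ => Real.exp (-(n : ℝ) * a) := by
    simpa [mul_comm] using Real.summable_exp_nat_mul_iff.mpr (neg_lt_zero.mpr ha)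
  exact Summable.of_nat_of_neg (by simpa using h) (by simpa using h)

lemma hasSum_poisson_kernel {a : ℝ} (ha : 0 < a) (x : ℝ) :
    HasSum
      (fun n : ℤ => (-1 : ℂ) ^ n * (Real.exp (-|(n : ℝ)| * a) : ℝ) *
        Complex.exp (Complex.I * (n : ℂ) * (x : ℂ)))
      ((Real.sinh a : ℝ) / ((Real.cosh a + Real.cos x : ℝ) : ℂ)) := by
  have hnorm (s : ℝ) : ‖-Complex.exp (-a + s * Complex.I)‖ < 1 := by
    simp [Complex.norm_exp, ha]
  have hsum := hasSum_int_of_geometric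
    (f := fun n : ℤ => (-1 : ℂ) ^ n * (Real.exp (-|(n : ℝ)| * a) : ℝ) *
        Complex.exp (Complex.I * (n : ℂ) * (x : ℂ))) (hnorm x) (hnorm (-x)) ?_ ?_
  · convert hsum using 1
    have h1 : 1 - -Complex.exp (-a + x * Complex.I) ≠ 0 := fun h => by
      have := hnorm x
      rw [← sub_eq_zero.mp h] at this
      simp at this
    have h2 : 1 - -Complex.exp (-a + (-x : ℝ) * Complex.I) ≠ 0 := fun h => by
      have := hnorm (-x)
      rw [← sub_eq_zero.mp h] at this
      simp at this
    have h3 : ((Real.cosh a + Real.cos x : ℝ) : ℂ) ≠ 0 := by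
      have : 1 < Real.cosh a := Real.one_lt_cosh.mpr ha.ne'
      exact_mod_cast (by linarith [Real.neg_one_le_cos x] : 0 < Real.cosh a + Real.cos x).ne'
    rw [div_eq_iff h3]
    push_cast at h1 h2 ⊢
    rw [Complex.cosh, Complex.sinh, Complex.cos]
    have e1 : Complex.exp (a : ℂ) ≠ 0 := Complex.exp_ne_zero _
    have e2 : Complex.exp (x * Complex.I : ℂ) ≠ 0 := Complex.exp_ne_zero _
    simp only [neg_mul, Complex.exp_add, Complex.exp_neg] at h1 h2 ⊢
    generalize Complex.exp (a : ℂ) = A at *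
    generalize Complex.exp (x * Complex.I : ℂ) = z at *
    have h1' : A + z ≠ 0 := fun h => h1 (by field_simp; linear_combination h)
    have h2' : A * z + 1 ≠ 0 := fun h => h2 (by field_simp; linear_combination h)
    have q1 : (1 - -(A⁻¹ * z))⁻¹ = A / (A + z) := by
      rw [inv_eq_iff_eq_inv, inv_div]; field_simp; ring
    have q2 : (1 - -(A⁻¹ * z⁻¹))⁻¹ = A * z / (A * z + 1) := by
      rw [inv_eq_iff_eq_inv, inv_div]; field_simp; ring
    rw [q1, q2]
    field_simp
    ring
  · intro n
    rw [neg_pow, ← Complex.exp_nat_mul, mul_assoc, Complex.ofReal_exp, ← Complex.exp_add]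
    simp only [zpow_natCast, Int.cast_natCast, Nat.abs_cast]
    congr 2
    push_cast
    ring
  · intro n
    rw [neg_pow, ← Complex.exp_nat_mul, mul_assoc, Complex.ofReal_exp, ← Complex.exp_add]
    have habs : |((-(n + 1 : ℤ) : ℤ) : ℝ)| = n + 1 := by
      push_cast
      rw [abs_neg, abs_of_nonneg (by positivity)]
    rw [habs, zpow_neg, ← inv_zpow, inv_neg_one]
    norm_cast
    congr 2
    push_cast
    ring

theorem fourier_coeff_inv_cosh_add_cos (a : ℝ) (ha : 0 < a) :
    (∀ n : ℤ,
      (((2 * π)⁻¹ : ℝ) : ℂ) *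
          ∫ t in (0 : ℝ)..(2 * π),
            (((Real.cosh a + Real.cos t)⁻¹ : ℝ) : ℂ) *
              Complex.exp (-Complex.I * (n : ℂ) * (t : ℂ)) =
        (-1 : ℂ) ^ n * (Real.exp (-(|n| : ℝ) * a) : ℝ) / (Real.sinh a : ℝ)) ∧
    (∀ x : ℝ,
      HasSum
        (fun n : ℤ =>
          (-1 : ℂ) ^ n * (Real.exp (-(|n| : ℝ) * a) : ℝ) *
            Complex.exp (Complex.I * (n : ℂ) * (x : ℂ)))
        ((Real.sinh a : ℝ) / ((Real.cosh a + Real.cos x : ℝ) : ℂ))) := by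
  refine ⟨fun n => ?_, hasSum_poisson_kernel ha⟩
  have hs : ((Real.sinh a : ℝ) : ℂ) ≠ 0 := by
    exact_mod_cast (Real.sinh_pos_iff.mpr ha).ne'
  have hint := intervalIntegral.hasSum_integral_of_dominated_convergence
    (μ := volume) (a := 0) (b := 2 * π)
    (F := fun (m : ℤ) (t : ℝ) => (-1 : ℂ) ^ m * (Real.exp (-|(m : ℝ)| * a) : ℝ) *
      Complex.exp (Complex.I * (m : ℂ) * (t : ℂ)) * Complex.exp (-Complex.I * (n : ℂ) * (t : ℂ)))
    (fun m _ => Real.exp (-|(m : ℝ)| * a))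
    (fun m => Continuous.aestronglyMeasurable (by fun_prop))
    (fun m => ae_of_all _ fun t _ => by
      simp [Complex.norm_exp, norm_zpow])
    (ae_of_all _ fun _ _ => summable_exp_neg_abs_mul ha)
    intervalIntegrable_const
    (ae_of_all _ fun t _ => (hasSum_poisson_kernel ha t).mul_right _)
  have hterm (m : ℤ) :
      ∫ t in (0 : ℝ)..(2 * π), (-1 : ℂ) ^ m * (Real.exp (-|(m : ℝ)| * a) : ℝ) *
        Complex.exp (Complex.I * (m : ℂ) * (t : ℂ)) *
          Complex.exp (-Complex.I * (n : ℂ) * (t : ℂ)) =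
      if m = n then (-1 : ℂ) ^ n * (Real.exp (-|(n : ℝ)| * a) : ℝ) * ((2 * π : ℝ) : ℂ) else 0 := by
    have h (t : ℝ) : (-1 : ℂ) ^ m * (Real.exp (-|(m : ℝ)| * a) : ℝ) *
        Complex.exp (Complex.I * (m : ℂ) * (t : ℂ)) *
          Complex.exp (-Complex.I * (n : ℂ) * (t : ℂ)) =
        (-1 : ℂ) ^ m * (Real.exp (-|(m : ℝ)| * a) : ℝ) *
          Complex.exp (Complex.I * ((m - n : ℤ) : ℂ) * (t : ℂ)) := by
      rw [mul_assoc _ (Complex.exp _), ← Complex.exp_add]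
      congr 2
      push_cast
      ring
    simp only [h, intervalIntegral.integral_const_mul, integral_exp_I_mul_int, sub_eq_zero]
    split_ifs with hmn
    · rw [hmn]
    · simp
  simp only [hterm] at hint
  have hval := hint.unique (hasSum_ite_eq n _)
  have hfun (t : ℝ) : (Real.sinh a : ℝ) / ((Real.cosh a + Real.cos t : ℝ) : ℂ) *
        Complex.exp (-Complex.I * (n : ℂ) * (t : ℂ)) =
      (Real.sinh a : ℝ) * ((((Real.cosh a + Real.cos t)⁻¹ : ℝ) : ℂ) *
        Complex.exp (-Complex.I * (n : ℂ) * (t : ℂ))) := by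
    rw [Complex.ofReal_inv, div_eq_mul_inv, mul_assoc]
  simp only [hfun, intervalIntegral.integral_const_mul] at hval
  have hpi : ((2 * π : ℝ) : ℂ) ≠ 0 := by exact_mod_cast Real.two_pi_pos.ne'
  rw [eq_div_iff hs, Complex.ofReal_inv, inv_mul_eq_div, div_mul_eq_mul_div, div_eq_iff hpi,
    mul_comm _ ((Real.sinh a : ℝ) : ℂ)]
  exact hval
end

section
/- For all positive real numbers a and b, ∫_{-∞}^{∞} dx/((cosh a + cos x)·cosh(bx)) = π/(b·sinh a) + (2π/(b·sinh a))·Σ_{n=1}^{∞} (-1)^n e^{-na}/cosh(πn/(2b)). -/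
open MeasureTheory Real Filter

lemma sigmoid_eq_exp_half_sub_log (y : ℝ) :
    Real.sigmoid y = Real.exp (y / 2 - Real.log (2 * Real.cosh (y / 2))) := by
  have hc : 0 < 2 * Real.cosh (y / 2) := by have := Real.cosh_pos (y / 2); positivity
  rw [Real.exp_sub, Real.exp_log hc, Real.sigmoid_def, Real.cosh_eq, inv_eq_iff_eq_inv, inv_div,
    eq_div_iff (Real.exp_ne_zero _), add_mul, ← Real.exp_add]
  ring_nf

/-- The Euler Beta integral at `1/2 ± it`, in the variable `y` with `x = sigmoid y`. -/
lemma integral_cexp_mul_I_div_two_mul_cosh_half (t : ℝ) :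
    ∫ y : ℝ, Complex.exp ((t * y : ℝ) * Complex.I) / ((2 * Real.cosh (y / 2) : ℝ) : ℂ) =
      ((π / Real.cosh (π * t) : ℝ) : ℂ) := by
  set u : ℂ := 1 / 2 + t * Complex.I with hu
  have hv : 1 - u = 1 / 2 - t * Complex.I := by rw [hu]; ring
  have hB : Complex.betaIntegral u (1 - u) = ((π / Real.cosh (π * t) : ℝ) : ℂ) := by
    have h := Complex.Gamma_mul_Gamma_eq_betaIntegral (s := u) (t := 1 - u)
      (by simp [hu]) (by simp [hv])
    rw [add_sub_cancel, Complex.Gamma_one, one_mul, Complex.Gamma_mul_Gamma_one_sub] at h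
    rw [← h, hu, show (π : ℂ) * (1 / 2 + t * Complex.I) = π * t * Complex.I + π / 2 by ring,
      Complex.sin_add_pi_div_two, Complex.cos_mul_I]
    push_cast
    rfl
  rw [← hB, Complex.betaIntegral, intervalIntegral.integral_of_le zero_le_one,
    integral_Ioc_eq_integral_Ioo, ← Real.range_sigmoid, ← Set.image_univ,
    integral_image_eq_integral_abs_deriv_smul MeasurableSet.univ
      (fun x _ => (Real.hasDerivAt_sigmoid x).hasDerivWithinAt)
      Real.sigmoid_injective.injOn, setIntegral_univ]
  refine integral_congr_ae (.of_forall fun y => ?_)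
  have hc : 0 < 2 * Real.cosh (y / 2) := by have := Real.cosh_pos (y / 2); positivity
  have h₁ := sigmoid_eq_exp_half_sub_log y
  have h₂ := sigmoid_eq_exp_half_sub_log (-y)
  rw [neg_div, Real.cosh_neg] at h₂
  have hcexp : ((2 * Real.cosh (y / 2) : ℝ) : ℂ) =
      Complex.exp (Real.log (2 * Real.cosh (y / 2)) : ℝ) := by
    rw [← Complex.ofReal_exp, Real.exp_log hc]
  dsimp only
  rw [← Complex.ofReal_one, ← Complex.ofReal_sub, ← Real.sigmoid_neg,
    abs_of_pos (mul_pos (Real.sigmoid_pos _) (Real.sigmoid_pos _)), hcexp, h₁, h₂]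
  set C := Real.log (2 * Real.cosh (y / 2))
  have hpow (r : ℝ) (w : ℂ) : ((Real.exp r : ℝ) : ℂ) ^ w = Complex.exp (r * w) := by
    rw [Complex.cpow_def_of_ne_zero (by exact_mod_cast Real.exp_ne_zero r),
      ← Complex.ofReal_log (Real.exp_pos r).le, Real.log_exp]
  rw [hpow, hpow, Complex.real_smul, Complex.ofReal_one, hv, hu, Complex.ofReal_mul (Real.exp _),
    Complex.ofReal_exp, Complex.ofReal_exp, ← Complex.exp_add, ← Complex.exp_add,
    ← Complex.exp_add, ← Complex.exp_sub]
  congr 1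
  push_cast
  ring

lemma integral_cos_mul_div_two_mul_cosh_half (t : ℝ) :
    ∫ y : ℝ, Real.cos (t * y) / (2 * Real.cosh (y / 2)) = π / Real.cosh (π * t) := by
  have h := integral_cexp_mul_I_div_two_mul_cosh_half t
  have hne : π / Real.cosh (π * t) ≠ 0 := div_ne_zero Real.pi_ne_zero (Real.cosh_pos _).ne'
  have hint := not_imp_comm.1 integral_undef (h.trans_ne (Complex.ofReal_ne_zero.2 hne))
  have hre := integral_re hint
  rw [h] at hre
  refine Eq.trans (integral_congr_ae (.of_forall fun y => ?_)) hre
  dsimp only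
  rw [RCLike.re_eq_complex_re, Complex.div_ofReal_re, Complex.exp_ofReal_mul_I_re]

/-- The Fourier transform of `1 / cosh`. -/
lemma integral_cos_mul_div_cosh_mul (t : ℝ) {b : ℝ} (hb : 0 < b) :
    ∫ x : ℝ, Real.cos (t * x) / Real.cosh (b * x) = π / b / Real.cosh (π * t / (2 * b)) := by
  have h := Measure.integral_comp_mul_left
    (fun y : ℝ => Real.cos (t / (2 * b) * y) / (2 * Real.cosh (y / 2))) (2 * b)
  rw [integral_cos_mul_div_two_mul_cosh_half, abs_of_pos (by positivity), smul_eq_mul] at h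
  have hcongr (x : ℝ) : Real.cos (t * x) / Real.cosh (b * x) =
      2 * (Real.cos (t / (2 * b) * (2 * b * x)) / (2 * Real.cosh (2 * b * x / 2))) := by
    rw [show t / (2 * b) * (2 * b * x) = t * x by field_simp,
      show 2 * b * x / 2 = b * x by ring]
    field_simp
  simp_rw [hcongr]
  rw [integral_const_mul, h, mul_div_assoc π t]
  field_simp

lemma integrable_cos_mul_div_cosh_mul (t : ℝ) {b : ℝ} (hb : 0 < b) :
    Integrable fun x : ℝ => Real.cos (t * x) / Real.cosh (b * x) := by
  refine not_imp_comm.1 integral_undef ?_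
  rw [integral_cos_mul_div_cosh_mul t hb]
  have := Real.cosh_pos (π * t / (2 * b))
  positivity

/-- The Fourier expansion of the Poisson kernel. -/
lemma hasSum_exp_mul_cos {a : ℝ} (ha : 0 < a) (x : ℝ) :
    HasSum (fun n : ℕ => (-1 : ℝ) ^ (n + 1) * Real.exp (-((n : ℝ) + 1) * a) *
        Real.cos (((n : ℝ) + 1) * x))
      ((Real.sinh a / (Real.cosh a + Real.cos x) - 1) / 2) := by
  set w : ℂ := -Complex.exp (-a + x * Complex.I) with hw
  have hnorm : ‖w‖ < 1 := by
    rw [hw, norm_neg, Complex.norm_exp]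
    simpa using ha
  have hs := Complex.hasSum_re ((hasSum_geometric_of_norm_lt_one hnorm).mul_left w)
  convert! hs using 1
  · funext n
    have : w * w ^ n = (((-1 : ℝ) ^ (n + 1) * Real.exp (-((n : ℝ) + 1) * a) : ℝ) : ℂ) *
        Complex.exp ((((n : ℝ) + 1) * x : ℝ) * Complex.I) := by
      rw [← pow_succ', hw, neg_pow, ← Complex.exp_nat_mul]
      push_cast
      rw [mul_assoc, ← Complex.exp_add]
      congr 2
      ring
    rw [this, Complex.re_ofReal_mul, Complex.exp_ofReal_mul_I_re]
  · have hre : w.re = -(Real.exp (-a) * Real.cos x) := by simp [hw, Complex.exp_re]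
    have him : w.im = -(Real.exp (-a) * Real.sin x) := by simp [hw, Complex.exp_im]
    have hr : Real.exp (-a) < 1 := by simpa using ha
    have hr0 := Real.exp_pos (-a)
    have hra : Real.exp a = (Real.exp (-a))⁻¹ := by rw [Real.exp_neg, inv_inv]
    rw [← div_eq_mul_inv, Complex.div_re, Complex.normSq_apply, Complex.sub_re, Complex.sub_im,
      Complex.one_re, Complex.one_im, hre, him, Real.sinh_eq, Real.cosh_eq, hra]
    set r := Real.exp (-a)
    have hsc := Real.sin_sq_add_cos_sq x
    have hc := Real.neg_one_le_cos x
    have hden : 0 < 1 + 2 * r * Real.cos x + r ^ 2 := by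
      nlinarith [mul_nonneg hr0.le (by linarith : (0 : ℝ) ≤ 1 + Real.cos x),
        sq_pos_of_pos (sub_pos.2 hr)]
    have h1 : (1 - -(r * Real.cos x)) * (1 - -(r * Real.cos x)) +
        (0 - -(r * Real.sin x)) * (0 - -(r * Real.sin x)) = 1 + 2 * r * Real.cos x + r ^ 2 := by
      linear_combination r ^ 2 * hsc
    have h2 : (r⁻¹ + r) / 2 + Real.cos x = (1 + 2 * r * Real.cos x + r ^ 2) / (2 * r) := by
      field_simp
      ring
    rw [h1, h2]
    generalize hD : 1 + 2 * r * Real.cos x + r ^ 2 = D at hden ⊢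
    field_simp
    linear_combination 2 * r ^ 2 * hsc + hD

/-- For `a, b > 0`,
`∫_ℝ dx/((cosh a + cos x) cosh(bx)) = π/(b sinh a) + (2π/(b sinh a)) ∑_{n ≥ 1} (-1)ⁿ e^{-na}/cosh(πn/(2b))`. -/
theorem integral_inv_cosh_add_cos_mul_cosh (a b : ℝ) (ha : 0 < a) (hb : 0 < b) :
    ∫ x : ℝ, ((Real.cosh a + Real.cos x) * Real.cosh (b * x))⁻¹ =
      π / (b * Real.sinh a) +
        2 * π / (b * Real.sinh a) *
          ∑' n : ℕ,
            (-1 : ℝ) ^ (n + 1) * Real.exp (-((n : ℝ) + 1) * a) /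
              Real.cosh (π * ((n : ℝ) + 1) / (2 * b)) := by
  have hsinh : 0 < Real.sinh a := Real.sinh_pos_iff.2 ha
  set c : ℕ → ℝ := fun n => (-1 : ℝ) ^ (n + 1) * Real.exp (-((n : ℝ) + 1) * a) with hc
  set F : ℕ → ℝ → ℝ := fun n x => c n * (Real.cos (((n : ℝ) + 1) * x) / Real.cosh (b * x)) with hF
  have hF_int (n : ℕ) : Integrable (F n) :=
    (integrable_cos_mul_div_cosh_mul _ hb).const_mul _
  have hcosh : Integrable fun x : ℝ => (Real.cosh (b * x))⁻¹ := by
    simpa using integrable_cos_mul_div_cosh_mul 0 hb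
  have hcosh_integral : ∫ x : ℝ, (Real.cosh (b * x))⁻¹ = π / b := by
    simpa using integral_cos_mul_div_cosh_mul 0 hb
  have hc_norm (n : ℕ) : ‖c n‖ = Real.exp (-a) * Real.exp (-a) ^ n := by
    rw [← pow_succ', ← Real.exp_nat_mul]
    simp only [hc, norm_mul, norm_pow, norm_neg, norm_one, one_pow, one_mul, Real.norm_eq_abs,
      Real.abs_exp]
    push_cast
    ring_nf
  have hF_sum : Summable fun n => ∫ x, ‖F n x‖ := by
    have hgeom : Summable fun n : ℕ => Real.exp (-a) * Real.exp (-a) ^ n * (π / b) :=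
      ((summable_geometric_of_lt_one (Real.exp_pos _).le (by simpa using ha)).mul_left _).mul_right _
    refine hgeom.of_nonneg_of_le (fun n => integral_nonneg fun x => norm_nonneg _) fun n => ?_
    rw [← hc_norm, ← hcosh_integral, ← integral_const_mul]
    refine integral_mono (hF_int n).norm (hcosh.const_mul _) fun x => ?_
    simp only [hF, norm_mul, norm_div, Real.norm_eq_abs, abs_of_pos (Real.cosh_pos (b * x))]
    rw [← one_div]
    have := Real.cosh_pos (b * x)
    gcongr
    exact Real.abs_cos_le_one _
  have hF_tsum (x : ℝ) : ∑' n, F n x =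
      (Real.sinh a / (Real.cosh a + Real.cos x) - 1) / 2 * (Real.cosh (b * x))⁻¹ := by
    rw [← ((hasSum_exp_mul_cos ha x).mul_right (Real.cosh (b * x))⁻¹).tsum_eq]
    simp only [hF, hc, div_eq_mul_inv, mul_assoc]
  have hsum := hasSum_integral_of_summable_integral_norm hF_int hF_sum
  have hsum_int : Integrable fun x => ∑' n, F n x := by
    simp_rw [hF_tsum]
    refine hcosh.bdd_mul (c := (Real.sinh a / (Real.cosh a - 1) + 1) / 2) ?_ (.of_forall fun x => ?_)
    · exact Measurable.aestronglyMeasurable (by fun_prop)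
    · have h1 : 1 < Real.cosh a := Real.one_lt_cosh.2 ha.ne'
      have h2 : Real.cosh a - 1 ≤ Real.cosh a + Real.cos x := by
        linarith [Real.neg_one_le_cos x]
      have h3 : Real.sinh a / (Real.cosh a + Real.cos x) ≤ Real.sinh a / (Real.cosh a - 1) := by
        have : 0 < Real.cosh a - 1 := by linarith
        gcongr
      have h4 : 0 ≤ Real.sinh a / (Real.cosh a + Real.cos x) :=
        div_nonneg hsinh.le (by linarith)
      rw [Real.norm_eq_abs, abs_le]
      constructor <;> linarith
  have hpt (x : ℝ) : ((Real.cosh a + Real.cos x) * Real.cosh (b * x))⁻¹ =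
      (Real.sinh a)⁻¹ * ((Real.cosh (b * x))⁻¹ + 2 * ∑' n, F n x) := by
    have h1 : 1 < Real.cosh a := Real.one_lt_cosh.2 ha.ne'
    have h2 : Real.cosh a + Real.cos x ≠ 0 := by linarith [Real.neg_one_le_cos x]
    have h3 := (Real.cosh_pos (b * x)).ne'
    rw [hF_tsum]
    field_simp
    ring
  simp_rw [hpt]
  rw [integral_const_mul, integral_add hcosh (hsum_int.const_mul 2), integral_const_mul,
    hcosh_integral, ← hsum.tsum_eq]
  simp_rw [hF, integral_const_mul, integral_cos_mul_div_cosh_mul _ hb]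
  have hterm (n : ℕ) : c n * (π / b / Real.cosh (π * ((n : ℝ) + 1) / (2 * b))) =
      π / b * (c n / Real.cosh (π * ((n : ℝ) + 1) / (2 * b))) := by ring
  simp_rw [hterm]
  rw [tsum_mul_left]
  simp only [hc]
  ring
end

section
/- Let f(x) = 1/(1 + e^{2|x|}). Then for every real ω, the Fourier transform f̂(ω) = ∫_ℝ f(t)e^{-iωt} dt satisfies f̂(ω) = Σ_{k=1}^{∞} (-1)^{k-1}·4k/(4k² + ω²). -/
open MeasureTheory Real Filter

section ExpNegMulAbs

variable {a : ℝ} (ω : ℝ)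

lemma exp_neg_mul_abs_mul_exp_eqOn_Ioi :
    Set.EqOn (fun t : ℝ => Complex.exp ((-(a : ℂ) - Complex.I * ω) * t))
      (fun t : ℝ => ((Real.exp (-a * |t|) : ℝ) : ℂ) *
        Complex.exp (-Complex.I * (ω : ℂ) * (t : ℂ))) (Set.Ioi 0) := by
  intro t ht
  have ht' : (0 : ℝ) < t := ht
  simp only [abs_of_pos ht', Complex.ofReal_exp, ← Complex.exp_add]
  push_cast
  ring_nf

lemma exp_neg_mul_abs_mul_exp_eqOn_Iic :
    Set.EqOn (fun t : ℝ => Complex.exp (((a : ℂ) - Complex.I * ω) * t))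
      (fun t : ℝ => ((Real.exp (-a * |t|) : ℝ) : ℂ) *
        Complex.exp (-Complex.I * (ω : ℂ) * (t : ℂ))) (Set.Iic 0) := by
  intro t ht
  have ht' : t ≤ 0 := ht
  simp only [abs_of_nonpos ht', Complex.ofReal_exp, ← Complex.exp_add]
  push_cast
  ring_nf

lemma integrableOn_exp_neg_mul_abs_mul_exp_Ioi (ha : 0 < a) :
    IntegrableOn (fun t : ℝ => ((Real.exp (-a * |t|) : ℝ) : ℂ) *
      Complex.exp (-Complex.I * (ω : ℂ) * (t : ℂ))) (Set.Ioi 0) :=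
  (integrableOn_exp_mul_complex_Ioi (by simpa using ha) 0).congr_fun
    (exp_neg_mul_abs_mul_exp_eqOn_Ioi ω) measurableSet_Ioi

lemma integrableOn_exp_neg_mul_abs_mul_exp_Iic (ha : 0 < a) :
    IntegrableOn (fun t : ℝ => ((Real.exp (-a * |t|) : ℝ) : ℂ) *
      Complex.exp (-Complex.I * (ω : ℂ) * (t : ℂ))) (Set.Iic 0) :=
  (integrableOn_exp_mul_complex_Iic (by simpa using ha) 0).congr_fun
    (exp_neg_mul_abs_mul_exp_eqOn_Iic ω) measurableSet_Iic

lemma integrable_exp_neg_mul_abs_mul_exp (ha : 0 < a) :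
    Integrable (fun t : ℝ => ((Real.exp (-a * |t|) : ℝ) : ℂ) *
      Complex.exp (-Complex.I * (ω : ℂ) * (t : ℂ))) := by
  rw [← integrableOn_univ, ← Set.Iic_union_Ioi (a := (0 : ℝ))]
  exact (integrableOn_exp_neg_mul_abs_mul_exp_Iic ω ha).union
    (integrableOn_exp_neg_mul_abs_mul_exp_Ioi ω ha)

/-- The Fourier transform of `t ↦ e^{-a|t|}`. -/
lemma integral_exp_neg_mul_abs_mul_exp (ha : 0 < a) :
    ∫ t : ℝ, ((Real.exp (-a * |t|) : ℝ) : ℂ) *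
      Complex.exp (-Complex.I * (ω : ℂ) * (t : ℂ)) = 2 * a / ((a : ℂ) ^ 2 + (ω : ℂ) ^ 2) := by
  rw [← intervalIntegral.integral_Iic_add_Ioi (integrableOn_exp_neg_mul_abs_mul_exp_Iic ω ha)
      (integrableOn_exp_neg_mul_abs_mul_exp_Ioi ω ha),
    ← setIntegral_congr_fun measurableSet_Iic (exp_neg_mul_abs_mul_exp_eqOn_Iic ω),
    ← setIntegral_congr_fun measurableSet_Ioi (exp_neg_mul_abs_mul_exp_eqOn_Ioi ω),
    integral_exp_mul_complex_Iic (by simpa using ha),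
    integral_exp_mul_complex_Ioi (by simpa using ha)]
  have h₁ : (a : ℂ) - Complex.I * ω ≠ 0 := fun h => ha.ne' (by simpa using congrArg Complex.re h)
  have h₂ : -(a : ℂ) - Complex.I * ω ≠ 0 := fun h => ha.ne' (by simpa using congrArg Complex.re h)
  have h₃ : (a : ℂ) ^ 2 + (ω : ℂ) ^ 2 = -((a - Complex.I * ω) * (-a - Complex.I * ω)) := by
    linear_combination (ω : ℂ) ^ 2 * Complex.I_sq
  rw [h₃]
  simp only [Complex.ofReal_zero, mul_zero, Complex.exp_zero]
  field_simp
  ring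

end ExpNegMulAbs

lemma sum_range_neg_one_pow_mul_pow_succ {x : ℝ} (hx : 0 < x) (N : ℕ) :
    ∑ k ∈ Finset.range N, (-1) ^ k * x ^ (k + 1) = x * (1 - (-x) ^ N) / (1 + x) := by
  have hx' : 1 + x ≠ 0 := by positivity
  induction N with
  | zero => simp
  | succ n ih =>
    rw [Finset.sum_range_succ, ih, neg_pow x n, neg_pow x (n + 1)]
    field_simp
    ring

lemma abs_sum_range_neg_one_pow_mul_pow_succ_le {x : ℝ} (hx : 0 < x) (hx₁ : x ≤ 1) (N : ℕ) :
    |∑ k ∈ Finset.range N, (-1) ^ k * x ^ (k + 1)| ≤ 2 * x := by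
  rw [sum_range_neg_one_pow_mul_pow_succ hx, abs_div, abs_mul, abs_of_pos hx,
    abs_of_pos (by positivity : 0 < 1 + x), div_le_iff₀ (by positivity)]
  have h : |1 - (-x) ^ N| ≤ 2 := by
    have h₁ : |(-x) ^ N| ≤ 1 := by
      rw [abs_pow, abs_neg, abs_of_pos hx]
      exact pow_le_one₀ hx.le hx₁
    rw [abs_le] at h₁ ⊢
    constructor <;> linarith [h₁.1, h₁.2]
  nlinarith [mul_le_mul_of_nonneg_left h hx.le]

lemma tendsto_sum_range_neg_one_pow_mul_pow_succ {x : ℝ} (hx : 0 < x) (hx₁ : x < 1) :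
    Tendsto (fun N : ℕ => ∑ k ∈ Finset.range N, (-1) ^ k * x ^ (k + 1)) atTop
      (nhds (1 + x⁻¹)⁻¹) := by
  simp only [sum_range_neg_one_pow_mul_pow_succ hx]
  have h := tendsto_pow_atTop_nhds_zero_of_abs_lt_one (r := -x) (by rwa [abs_neg, abs_of_pos hx])
  convert ((h.const_sub 1).const_mul x).div_const (1 + x) using 2
  field_simp
  ring

/-- For `f(x) = 1/(1 + e^{2|x|})` and every real `ω`,
`f̂(ω) = ∑_{k ≥ 1} (-1)^{k-1} 4k/(4k² + ω²)` (the series being summed in order). -/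
theorem fourierTransform_inv_one_add_exp_two_abs (ω : ℝ) :
    Tendsto
      (fun N : ℕ => ∑ k ∈ Finset.range N,
        (-1 : ℂ) ^ k * (4 * ((k : ℂ) + 1)) / (4 * ((k : ℂ) + 1) ^ 2 + (ω : ℂ) ^ 2))
      atTop
      (nhds (∫ t : ℝ,
        (((1 + Real.exp (2 * |t|))⁻¹ : ℝ) : ℂ) * Complex.exp (-Complex.I * (ω : ℂ) * (t : ℂ)))) := by
  have hsum (N : ℕ) : ∑ k ∈ Finset.range N,
      (-1 : ℂ) ^ k * (4 * ((k : ℂ) + 1)) / (4 * ((k : ℂ) + 1) ^ 2 + (ω : ℂ) ^ 2) =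
      ∫ t : ℝ, ((∑ k ∈ Finset.range N, (-1) ^ k * Real.exp (-2 * |t|) ^ (k + 1) : ℝ) : ℂ) *
        Complex.exp (-Complex.I * (ω : ℂ) * (t : ℂ)) := by
    have hpow (k : ℕ) (t : ℝ) :
        Real.exp (-2 * |t|) ^ (k + 1) = Real.exp (-(2 * ((k : ℝ) + 1)) * |t|) := by
      rw [← Real.exp_nat_mul]
      push_cast
      ring_nf
    have hpos (k : ℕ) : (0 : ℝ) < 2 * ((k : ℝ) + 1) := by positivity
    simp only [hpow, Complex.ofReal_sum, Finset.sum_mul, Complex.ofReal_mul,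
      mul_assoc (Complex.ofReal ((-1) ^ _))]
    rw [integral_finsetSum _ fun k _ =>
      (integrable_exp_neg_mul_abs_mul_exp ω (hpos k)).const_mul (Complex.ofReal ((-1) ^ k))]
    refine Finset.sum_congr rfl fun k _ => ?_
    rw [integral_const_mul, integral_exp_neg_mul_abs_mul_exp ω (hpos k)]
    push_cast
    ring_nf
  have hnorm (t : ℝ) : ‖Complex.exp (-Complex.I * (ω : ℂ) * (t : ℂ))‖ = 1 := by
    simp [Complex.norm_exp]
  simp only [hsum]
  refine tendsto_integral_of_dominated_convergence (fun t => 2 * Real.exp (-2 * |t|))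
    (fun N => (by fun_prop : Continuous _).aestronglyMeasurable) ?_ (fun N => ?_) ?_
  · have h := (integrable_exp_neg_mul_abs_mul_exp (a := 2) 0 two_pos).norm.const_mul 2
    simpa [Complex.norm_exp] using h
  · filter_upwards with t
    rw [norm_mul, hnorm, mul_one, Complex.norm_real, Real.norm_eq_abs]
    exact abs_sum_range_neg_one_pow_mul_pow_succ_le (Real.exp_pos _) (by simp) N
  · filter_upwards [compl_mem_ae_iff.mpr (measure_singleton (0 : ℝ))] with t ht
    have ht' : 0 < |t| := abs_pos.mpr ht
    have h := tendsto_sum_range_neg_one_pow_mul_pow_succ (Real.exp_pos (-2 * |t|))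
      (by rw [Real.exp_lt_one_iff]; linarith)
    rw [← Real.exp_neg, neg_mul, neg_neg] at h
    exact ((Complex.continuous_ofReal.tendsto _).comp (by simpa using h)).mul_const _
end

section
/- The 2π-periodic function g(x) = log(cos²x) has exponential Fourier coefficients: C_{2n+1}(g) = 0 for all n ∈ ℤ, C_0(g) = -2·log 2, and C_{2n}(g) = (-1)^{n-1}/|n| for every nonzero n ∈ ℤ. -/
open MeasureTheory Real Filter

/-- A quotient of `sin (2 (n + 1) s)` by `sin s`, with a primitive of the product of the quotient
and `cos s`. -/
lemma exists_sin_mul_eq_and_primitive (n : ℕ) :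
    ∃ q P : ℝ → ℝ, Continuous q ∧ (∀ s, sin (2 * (n + 1) * s) = sin s * q s) ∧
      (∀ s, HasDerivAt P (q s * cos s) s) ∧ P 0 = 0 ∧ P π = π := by
  induction n with
  | zero =>
    refine ⟨fun s ↦ 2 * cos s, fun s ↦ s + sin s * cos s, by fun_prop, fun s ↦ ?_, fun s ↦ ?_,
      by simp, by simp⟩
    · simp only [Nat.cast_zero, zero_add, mul_one, sin_two_mul]
      ring
    · refine ((hasDerivAt_id s).add ((hasDerivAt_sin s).mul (hasDerivAt_cos s))).congr_deriv ?_
      linear_combination -sin_sq_add_cos_sq s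
  | succ n ih =>
    obtain ⟨q, P, hq, hsin, hP, hP0, hPπ⟩ := ih
    have hderiv (a : ℝ) (ha : a ≠ 0) (s : ℝ) :
        HasDerivAt (fun s ↦ sin (a * s) / a) (cos (a * s)) s := by
      refine (((hasDerivAt_id s).const_mul a).sin.div_const a).congr_deriv ?_
      simp [ha]
    have hsinπ (k : ℕ) : sin (2 * (k + 1) * π) = 0 := by
      simpa using sin_nat_mul_pi (2 * (k + 1))
    refine ⟨fun s ↦ q s + 2 * cos ((2 * n + 3) * s),
      fun s ↦ P s + (sin (2 * ((n + 1 : ℕ) + 1) * s) / (2 * ((n + 1 : ℕ) + 1))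
        + sin (2 * (n + 1) * s) / (2 * (n + 1))),
      by fun_prop, fun s ↦ ?_, fun s ↦ ?_, by simp [hP0], by simp only [hPπ, hsinπ]; simp⟩
    · have h₁ : 2 * (((n + 1 : ℕ) : ℝ) + 1) * s = (2 * n + 3) * s + s := by push_cast; ring
      have h₂ : 2 * ((n : ℝ) + 1) * s = (2 * n + 3) * s - s := by ring
      rw [mul_add (sin s), ← hsin, h₁, h₂, sin_add, sin_sub]
      ring
    · refine ((hP s).add ((hderiv (2 * ((n + 1 : ℕ) + 1)) (by positivity) s).add
        (hderiv (2 * (n + 1)) (by positivity) s))).congr_deriv ?_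
      have h₁ : 2 * (((n + 1 : ℕ) : ℝ) + 1) * s = (2 * n + 3) * s + s := by push_cast; ring
      have h₂ : 2 * ((n : ℝ) + 1) * s = (2 * n + 3) * s - s := by ring
      rw [h₁, h₂, cos_add, cos_sub]
      ring

lemma integral_log_sin_mul_cos (n : ℕ) :
    ∫ s in (0 : ℝ)..π, log (sin s) * cos (2 * (n + 1) * s) = -π / (2 * (n + 1)) := by
  obtain ⟨q, P, hq, hsin, hP, hP0, hPπ⟩ := exists_sin_mul_eq_and_primitive n
  have ha : (2 * ((n : ℝ) + 1)) ≠ 0 := by positivity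
  have hcont : Continuous fun s ↦ (sin s * log (sin s) * q s - P s) / (2 * ((n : ℝ) + 1)) := by
    have hPc : Continuous P := continuous_iff_continuousAt.2 fun s ↦ (hP s).continuousAt
    have := continuous_mul_log.comp continuous_sin
    exact ((this.mul hq).sub hPc).div_const _
  have hint : IntervalIntegrable (fun s ↦ log (sin s) * cos (2 * (n + 1) * s)) volume 0 π :=
    (intervalIntegrable_log_sin (a := 0) (b := π)).mul_continuousOn (by fun_prop)
  rw [intervalIntegral.integral_eq_sub_of_hasDerivAt_of_le pi_pos.le hcont.continuousOn
    (fun s hs ↦ ?_) hint]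
  · simp only [hP0, hPπ, sin_pi, sin_zero]
    ring
  · have hs0 : sin s ≠ 0 := (sin_pos_of_pos_of_lt_pi hs.1 hs.2).ne'
    have hfun : (fun s ↦ (sin s * log (sin s) * q s - P s) / (2 * ((n : ℝ) + 1))) =
        fun s ↦ (log (sin s) * sin (2 * (n + 1) * s) - P s) / (2 * ((n : ℝ) + 1)) := by
      ext s
      rw [hsin]
      ring
    rw [hfun]
    refine (((((hasDerivAt_sin s).log hs0).mul
      (((hasDerivAt_id s).const_mul (2 * ((n : ℝ) + 1))).sin)).sub (hP s)).div_const
        _).congr_deriv ?_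
    simp only [id, hsin]
    field_simp
    ring

lemma intervalIntegrable_log_sin_mul_exp (m : ℤ) (a b : ℝ) :
    IntervalIntegrable (fun s : ℝ ↦ (log (sin s) : ℂ) * Complex.exp (-Complex.I * m * s))
      volume a b := by
  have h : IntervalIntegrable (fun s ↦ ((log (sin s) : ℝ) : ℂ)) volume a b :=
    ⟨intervalIntegrable_log_sin.1.ofReal, intervalIntegrable_log_sin.2.ofReal⟩
  exact h.mul_continuousOn (by fun_prop)

lemma integral_log_sin_mul_exp (n : ℤ) :
    ∫ s in (0 : ℝ)..π, (log (sin s) : ℂ) * Complex.exp (-Complex.I * (2 * n : ℤ) * s) =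
      ((∫ s in (0 : ℝ)..π, log (sin s) * cos (2 * n.natAbs * s) : ℝ) : ℂ) := by
  have hrefl : ∫ s in (0 : ℝ)..π, (log (sin s) : ℂ) * Complex.exp (-Complex.I * (2 * n : ℤ) * s) =
      ∫ s in (0 : ℝ)..π, (log (sin s) : ℂ) * Complex.exp (-Complex.I * (2 * (-n) : ℤ) * s) := by
    have h := intervalIntegral.integral_comp_sub_left (a := 0) (b := π)
      (fun s : ℝ ↦ (log (sin s) : ℂ) * Complex.exp (-Complex.I * (2 * n : ℤ) * s)) π
    rw [sub_self, sub_zero] at h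
    rw [← h]
    congr 1 with s
    rw [sin_pi_sub]
    congr 1
    rw [Complex.exp_eq_exp_iff_exists_int]
    exact ⟨-n, by push_cast; ring⟩
  have hcos (s : ℝ) : (log (sin s) : ℂ) * Complex.exp (-Complex.I * (2 * n : ℤ) * s) +
      (log (sin s) : ℂ) * Complex.exp (-Complex.I * (2 * (-n) : ℤ) * s) =
      2 * ((log (sin s) * cos (2 * n.natAbs * s) : ℝ) : ℂ) := by
    have habs : cos (2 * n.natAbs * s) = cos (2 * n * s) := by
      rw [Nat.cast_natAbs, Int.cast_abs, ← cos_abs (2 * n * s), ← cos_abs (2 * _ * s)]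
      simp [abs_mul]
    rw [habs]
    push_cast
    rw [Complex.cos]
    ring_nf
  have hadd := intervalIntegral.integral_add (intervalIntegrable_log_sin_mul_exp (2 * n) 0 π)
    (intervalIntegrable_log_sin_mul_exp (2 * (-n)) 0 π)
  simp only [hcos] at hadd
  rw [← hrefl, intervalIntegral.integral_const_mul, intervalIntegral.integral_ofReal] at hadd
  linear_combination -hadd / 2

lemma integral_log_cos_sq_mul_exp (m : ℤ) :
    ∫ t in (0 : ℝ)..(2 * π), ((log (cos t ^ 2) : ℝ) : ℂ) * Complex.exp (-Complex.I * m * t) =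
      2 * (1 + Complex.exp (-Complex.I * m * π)) * Complex.exp (-Complex.I * m * (π / 2)) *
        ∫ s in (0 : ℝ)..π, (log (sin s) : ℂ) * Complex.exp (-Complex.I * m * s) := by
  set F : ℝ → ℂ := fun t ↦ ((log (cos t ^ 2) : ℝ) : ℂ) * Complex.exp (-Complex.I * m * t)
  set G : ℝ → ℂ := fun s ↦ (log (sin s) : ℂ) * Complex.exp (-Complex.I * m * s)
  have hper : Function.Periodic F (2 * π) := fun t ↦ by
    simp only [F, cos_add_two_pi]
    congr 1
    rw [Complex.exp_eq_exp_iff_exists_int]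
    exact ⟨-m, by push_cast; ring⟩
  have hshift (s : ℝ) : F (s + π / 2) = 2 * Complex.exp (-Complex.I * m * (π / 2)) * G s := by
    simp only [F, G, cos_add_pi_div_two, log_pow, log_neg_eq_log]
    push_cast
    rw [mul_add, Complex.exp_add]
    ring
  have hG (s : ℝ) : G (s + π) = Complex.exp (-Complex.I * m * π) * G s := by
    simp only [G, sin_add_pi, log_neg_eq_log]
    push_cast
    rw [mul_add, Complex.exp_add]
    ring
  have hGint : ∫ s in (0 : ℝ)..(2 * π), G s =
      (1 + Complex.exp (-Complex.I * m * π)) * ∫ s in (0 : ℝ)..π, G s := by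
    rw [← intervalIntegral.integral_add_adjacent_intervals
      (intervalIntegrable_log_sin_mul_exp m 0 π) (intervalIntegrable_log_sin_mul_exp m π (2 * π))]
    have h := intervalIntegral.integral_comp_add_right (a := 0) (b := π) G π
    rw [zero_add, ← two_mul] at h
    simp only [hG, intervalIntegral.integral_const_mul] at h
    rw [add_mul, one_mul, h]
  have h₁ := hper.intervalIntegral_add_eq 0 (π / 2)
  have h₂ := intervalIntegral.integral_comp_add_right (a := 0) (b := 2 * π) F (π / 2)
  simp only [hshift, intervalIntegral.integral_const_mul] at h₂
  rw [zero_add] at h₁ h₂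
  rw [h₁, add_comm (π / 2), ← h₂, hGint]
  ring

lemma integral_log_cos_sq_mul_exp_odd (n : ℤ) :
    ∫ t in (0 : ℝ)..(2 * π), ((log (cos t ^ 2) : ℝ) : ℂ) *
      Complex.exp (-Complex.I * (2 * n + 1 : ℤ) * t) = 0 := by
  have h : Complex.exp (-Complex.I * (2 * n + 1 : ℤ) * π) = -1 := by
    rw [← Complex.exp_pi_mul_I, Complex.exp_eq_exp_iff_exists_int]
    exact ⟨-n - 1, by push_cast; ring⟩
  rw [integral_log_cos_sq_mul_exp, h]
  ring

lemma integral_log_cos_sq_mul_exp_even (n : ℤ) :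
    ∫ t in (0 : ℝ)..(2 * π), ((log (cos t ^ 2) : ℝ) : ℂ) *
        Complex.exp (-Complex.I * (2 * n : ℤ) * t) =
      4 * (-1) ^ n * ((∫ s in (0 : ℝ)..π, log (sin s) * cos (2 * n.natAbs * s) : ℝ) : ℂ) := by
  have h : Complex.exp (-Complex.I * (2 * n : ℤ) * π) = 1 := by
    rw [Complex.exp_eq_one_iff]
    exact ⟨-n, by push_cast; ring⟩
  have hhalf : Complex.exp (-Complex.I * (2 * n : ℤ) * (π / 2)) = (-1) ^ n := by
    rw [← Complex.exp_pi_mul_I, ← Complex.exp_int_mul, Complex.exp_eq_exp_iff_exists_int]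
    exact ⟨-n, by push_cast; ring⟩
  rw [integral_log_cos_sq_mul_exp, h, hhalf, integral_log_sin_mul_exp]
  ring

/-- The `2π`-periodic function `g(x) = log(cos² x)` has Fourier coefficients
`C_{2n+1}(g) = 0`, `C₀(g) = -2 log 2`, and `C_{2n}(g) = (-1)^{n-1}/|n|` for `n ≠ 0`. -/
theorem fourier_coeff_log_cos_sq :
    (∀ n : ℤ,
      (((2 * π)⁻¹ : ℝ) : ℂ) *
          ∫ t in (0 : ℝ)..(2 * π),
            ((Real.log (Real.cos t ^ 2) : ℝ) : ℂ) *
              Complex.exp (-Complex.I * ((2 * n + 1 : ℤ) : ℂ) * (t : ℂ)) = 0) ∧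
    ((((2 * π)⁻¹ : ℝ) : ℂ) *
        ∫ t in (0 : ℝ)..(2 * π),
          ((Real.log (Real.cos t ^ 2) : ℝ) : ℂ) *
            Complex.exp (-Complex.I * ((0 : ℤ) : ℂ) * (t : ℂ)) = -2 * (Real.log 2 : ℝ)) ∧
    (∀ n : ℤ, n ≠ 0 →
      (((2 * π)⁻¹ : ℝ) : ℂ) *
          ∫ t in (0 : ℝ)..(2 * π),
            ((Real.log (Real.cos t ^ 2) : ℝ) : ℂ) *
              Complex.exp (-Complex.I * ((2 * n : ℤ) : ℂ) * (t : ℂ)) =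
        (-1 : ℂ) ^ (n - 1) / ((|n| : ℤ) : ℂ)) := by
  have hπ : (π : ℂ) ≠ 0 := by exact_mod_cast pi_ne_zero
  refine ⟨fun n ↦ ?_, ?_, fun n hn ↦ ?_⟩
  · rw [integral_log_cos_sq_mul_exp_odd, mul_zero]
  · have h := integral_log_cos_sq_mul_exp_even 0
    rw [mul_zero] at h
    rw [h]
    simp only [Int.natAbs_zero, Nat.cast_zero, mul_zero, zero_mul, cos_zero, mul_one, zpow_zero,
      integral_log_sin_zero_pi]
    push_cast
    field_simp
    ring
  · obtain ⟨k, hk⟩ := Nat.exists_eq_succ_of_ne_zero (Int.natAbs_ne_zero.2 hn)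
    have habs : |n| = (k : ℤ) + 1 := by
      rw [Int.abs_eq_natAbs, hk]
      push_cast
      rfl
    have hk0 : (k : ℂ) + 1 ≠ 0 := by exact_mod_cast k.succ_ne_zero
    rw [integral_log_cos_sq_mul_exp_even, hk, habs, zpow_sub_one₀ (by norm_num),
      Nat.cast_succ, integral_log_sin_mul_cos]
    push_cast
    field_simp
    norm_num
end

section
/- The iterated double series J := Σ_{n=1}^{∞} ( Σ_{k=1}^{∞} (-1)^{k+n}·k/((k² + n²)·n) ) converges, equals the iterated series with the order of summation exchanged, Σ_{k=1}^{∞} ( Σ_{n=1}^{∞} (-1)^{k+n}·n/(k·(n² + k²)) ), and its value is J = (log 2)²/2. -/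
open MeasureTheory Real Filter

/-- The Leibniz criterion for a sequence that is antitone only from the index `m` on, with the
bound for the error of the partial sum at `m`. -/
theorem AntitoneOn.exists_tendsto_alternating_series {g : ℕ → ℝ} {m : ℕ}
    (hg : AntitoneOn g (Set.Ici m)) (hg0 : Tendsto g atTop (nhds 0)) :
    ∃ l, Tendsto (fun K : ℕ => ∑ k ∈ Finset.range K, (-1 : ℝ) ^ k * g k) atTop (nhds l) ∧
      ∀ N, m ≤ N → |l - ∑ k ∈ Finset.range N, (-1 : ℝ) ^ k * g k| ≤ g N := by
  have shift : ∀ N, m ≤ N →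
      ∃ l, Tendsto (fun K : ℕ => ∑ k ∈ Finset.range K, (-1 : ℝ) ^ k * g k) atTop (nhds l) ∧
        |l - ∑ k ∈ Finset.range N, (-1 : ℝ) ^ k * g k| ≤ g N := by
    intro N hN
    have ha : Antitone fun i => g (N + i) := fun i j hij =>
      hg (Set.mem_Ici.2 (by omega)) (Set.mem_Ici.2 (by omega)) (by omega)
    have h0 : Tendsto (fun i => g (N + i)) atTop (nhds 0) := by
      simpa only [add_comm] using (tendsto_add_atTop_iff_nat N).2 hg0
    obtain ⟨l, hl⟩ := ha.tendsto_alternating_series_of_tendsto_zero h0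
    have lower := ha.alternating_series_le_tendsto hl 0
    have upper := ha.tendsto_le_alternating_series hl 0
    simp only [mul_zero, Finset.range_zero, Finset.sum_empty, zero_add, Finset.sum_range_one,
      pow_zero, one_mul, add_zero] at lower upper
    refine ⟨∑ k ∈ Finset.range N, (-1 : ℝ) ^ k * g k + (-1) ^ N * l, ?_, ?_⟩
    · rw [← tendsto_add_atTop_iff_nat N]
      refine ((hl.const_mul ((-1 : ℝ) ^ N)).const_add
        (∑ k ∈ Finset.range N, (-1 : ℝ) ^ k * g k)).congr fun K => ?_
      rw [add_comm K N, Finset.sum_range_add, Finset.mul_sum]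
      simp only [pow_add, mul_assoc]
    · rw [add_sub_cancel_left, abs_mul, abs_pow, abs_neg, abs_one, one_pow, one_mul,
        abs_of_nonneg lower]
      exact upper
  obtain ⟨l, hl, -⟩ := shift m le_rfl
  refine ⟨l, hl, fun N hN => ?_⟩
  obtain ⟨l', hl', hb⟩ := shift N hN
  rwa [tendsto_nhds_unique hl hl']

/-- The alternating harmonic series sums to `log 2`. -/
theorem tendsto_alternating_harmonic :
    Tendsto (fun N : ℕ => ∑ k ∈ Finset.range N, (-1 : ℝ) ^ k * (1 / ((k : ℝ) + 1)))
      atTop (nhds (Real.log 2)) := by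
  have ha : Antitone fun k : ℕ => 1 / ((k : ℝ) + 1) := fun i j hij =>
    Nat.one_div_le_one_div hij
  obtain ⟨l, hl⟩ :=
    ha.tendsto_alternating_series_of_tendsto_zero tendsto_one_div_add_atTop_nhds_zero_nat
  have abel := Real.tendsto_tsum_powerSeries_nhdsWithin_lt hl
  have hid : Tendsto (fun x : ℝ => x) (nhdsWithin 1 (Set.Iio 1)) (nhds 1) :=
    tendsto_id.mono_left nhdsWithin_le_nhds
  have hlog : Tendsto (fun x : ℝ => Real.log (1 + x)) (nhdsWithin 1 (Set.Iio 1))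
      (nhds (Real.log 2)) := by
    have h := (hid.const_add 1).log (by norm_num)
    rwa [one_add_one_eq_two] at h
  have heq : (fun x : ℝ => x * ∑' k : ℕ, (-1 : ℝ) ^ k * (1 / ((k : ℝ) + 1)) * x ^ k)
      =ᶠ[nhdsWithin 1 (Set.Iio 1)] fun x => Real.log (1 + x) := by
    filter_upwards [Ioo_mem_nhdsLT (show (0 : ℝ) < 1 by norm_num)] with x hx
    have hs := (Real.hasSum_pow_div_log_of_abs_lt_one (x := -x)
      (by rw [abs_neg, abs_of_pos hx.1]; exact hx.2)).neg
    rw [neg_neg, sub_neg_eq_add] at hs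
    rw [← tsum_mul_left, ← hs.tsum_eq]
    refine tsum_congr fun k => ?_
    rw [neg_pow x]
    ring
  have h := tendsto_nhds_unique ((hid.mul abel).congr' heq) hlog
  rw [one_mul] at h
  rwa [h] at hl

theorem antitoneOn_div_sq_add_sq (c : ℕ) :
    AntitoneOn (fun k : ℕ => ((k : ℝ) + 1) / (((k : ℝ) + 1) ^ 2 + ((c : ℝ) + 1) ^ 2))
      (Set.Ici c) := by
  intro i hi j _ hij
  have hci : (c : ℝ) ≤ i := by exact_mod_cast hi
  have hij' : (i : ℝ) ≤ j := by exact_mod_cast hij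
  have hc : (0 : ℝ) ≤ c := c.cast_nonneg
  have hprod : ((c : ℝ) + 1) ^ 2 ≤ ((i : ℝ) + 1) * ((j : ℝ) + 1) := by nlinarith
  simp only
  rw [div_le_div_iff₀ (by positivity) (by positivity)]
  nlinarith [mul_nonneg (sub_nonneg.2 hij') (sub_nonneg.2 hprod)]

theorem div_sq_add_sq_le (c k : ℕ) :
    ((k : ℝ) + 1) / (((k : ℝ) + 1) ^ 2 + ((c : ℝ) + 1) ^ 2) ≤ 1 / ((k : ℝ) + 1) := by
  rw [div_le_div_iff₀ (by positivity) (by positivity)]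
  nlinarith [sq_nonneg ((c : ℝ) + 1)]

theorem tendsto_div_sq_add_sq (c : ℕ) :
    Tendsto (fun k : ℕ => ((k : ℝ) + 1) / (((k : ℝ) + 1) ^ 2 + ((c : ℝ) + 1) ^ 2))
      atTop (nhds 0) :=
  squeeze_zero (fun k => by positivity) (div_sq_add_sq_le c)
    tendsto_one_div_add_atTop_nhds_zero_nat

/-- The square partial sums of the double series, by symmetrization. -/
theorem sum_sum_eq_sq_div_two (N : ℕ) :
    ∑ n ∈ Finset.range N, ∑ k ∈ Finset.range N,
        (-1 : ℝ) ^ ((k + 1) + (n + 1)) * ((k : ℝ) + 1) /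
          ((((k : ℝ) + 1) ^ 2 + ((n : ℝ) + 1) ^ 2) * ((n : ℝ) + 1)) =
      (∑ k ∈ Finset.range N, (-1 : ℝ) ^ k * (1 / ((k : ℝ) + 1))) ^ 2 / 2 := by
  rw [eq_div_iff two_ne_zero, mul_two]
  nth_rw 2 [Finset.sum_comm]
  rw [sq, Finset.sum_mul_sum, ← Finset.sum_add_distrib]
  refine Finset.sum_congr rfl fun n _ => ?_
  rw [← Finset.sum_add_distrib]
  refine Finset.sum_congr rfl fun k _ => ?_
  have hk : (k : ℝ) + 1 ≠ 0 := by positivity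
  have hn : (n : ℝ) + 1 ≠ 0 := by positivity
  have hs : ((k : ℝ) + 1) ^ 2 + ((n : ℝ) + 1) ^ 2 ≠ 0 := by positivity
  have hs' : ((n : ℝ) + 1) ^ 2 + ((k : ℝ) + 1) ^ 2 ≠ 0 := by positivity
  simp only [pow_succ (-1 : ℝ), pow_add (-1 : ℝ)]
  field_simp
  ring

/-- If the `n`-th row sum differs from its `N`-th partial sum by at most `1 / ((N+1)(n+1))` for
`n ≤ N`, then the sums of the first `N` rows and the square partial sums have the same limit. -/
theorem tendsto_sum_of_abs_sub_le {a : ℕ → ℝ} {f : ℕ → ℕ → ℝ} {L : ℝ}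
    (hf : Tendsto (fun N : ℕ => ∑ n ∈ Finset.range N, ∑ k ∈ Finset.range N, f n k)
      atTop (nhds L))
    (ha : ∀ n N : ℕ, n ≤ N →
      |a n - ∑ k ∈ Finset.range N, f n k| ≤ 1 / ((N : ℝ) + 1) * (1 / ((n : ℝ) + 1))) :
    Tendsto (fun N : ℕ => ∑ n ∈ Finset.range N, a n) atTop (nhds L) := by
  have hdiff : Tendsto (fun N : ℕ => ∑ n ∈ Finset.range N, (a n - ∑ k ∈ Finset.range N, f n k))
      atTop (nhds 0) := by
    refine squeeze_zero_norm (fun N => ?_)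
      (tendsto_one_div_add_atTop_nhds_zero_nat (𝕜 := ℝ)).cesaro
    rw [Finset.mul_sum]
    refine norm_sum_le_of_le _ fun n hn => ?_
    have hnN := Finset.mem_range.1 hn
    refine (ha n N hnN.le).trans ?_
    have hN : (0 : ℝ) < N := by exact_mod_cast Nat.zero_lt_of_lt hnN
    rw [← one_div]
    gcongr
    linarith
  have h := hdiff.add hf
  rw [zero_add] at h
  refine h.congr fun N => ?_
  rw [Finset.sum_sub_distrib, sub_add_cancel]

/-- The iterated double series `J = ∑_{n ≥ 1} ∑_{k ≥ 1} (-1)^{k+n} k/((k²+n²)n)` converges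
(each inner series converging as a limit of partial sums), equals the iterated series with the
order of summation exchanged, `∑_{k ≥ 1} ∑_{n ≥ 1} (-1)^{k+n} n/(k(n²+k²))`, and its common
value is `(log 2)²/2`. -/
theorem double_series_value :
    ∃ a b : ℕ → ℝ,
      (∀ n : ℕ,
        Tendsto
          (fun K : ℕ => ∑ k ∈ Finset.range K,
            (-1 : ℝ) ^ ((k + 1) + (n + 1)) * ((k : ℝ) + 1) /
              ((((k : ℝ) + 1) ^ 2 + ((n : ℝ) + 1) ^ 2) * ((n : ℝ) + 1)))
          atTop (nhds (a n))) ∧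
      (∀ k : ℕ,
        Tendsto
          (fun N : ℕ => ∑ n ∈ Finset.range N,
            (-1 : ℝ) ^ ((k + 1) + (n + 1)) * ((n : ℝ) + 1) /
              (((k : ℝ) + 1) * (((n : ℝ) + 1) ^ 2 + ((k : ℝ) + 1) ^ 2)))
          atTop (nhds (b k))) ∧
      Tendsto (fun N : ℕ => ∑ n ∈ Finset.range N, a n) atTop (nhds (Real.log 2 ^ 2 / 2)) ∧
      Tendsto (fun K : ℕ => ∑ k ∈ Finset.range K, b k) atTop (nhds (Real.log 2 ^ 2 / 2)) := by
  choose l hl hbound using fun n : ℕ =>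
    (antitoneOn_div_sq_add_sq n).exists_tendsto_alternating_series (tendsto_div_sq_add_sq n)
  let c : ℕ → ℝ := fun n => (-1) ^ n / ((n : ℝ) + 1)
  have hterm : ∀ n k : ℕ, (-1 : ℝ) ^ ((k + 1) + (n + 1)) * ((k : ℝ) + 1) /
      ((((k : ℝ) + 1) ^ 2 + ((n : ℝ) + 1) ^ 2) * ((n : ℝ) + 1)) =
      c n * ((-1) ^ k * (((k : ℝ) + 1) / (((k : ℝ) + 1) ^ 2 + ((n : ℝ) + 1) ^ 2))) := by
    intro n k
    simp only [c, pow_succ (-1 : ℝ), pow_add (-1 : ℝ)]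
    field_simp
  have hrow : ∀ n : ℕ, Tendsto
      (fun K : ℕ => ∑ k ∈ Finset.range K,
        (-1 : ℝ) ^ ((k + 1) + (n + 1)) * ((k : ℝ) + 1) /
          ((((k : ℝ) + 1) ^ 2 + ((n : ℝ) + 1) ^ 2) * ((n : ℝ) + 1)))
      atTop (nhds (c n * l n)) := by
    intro n
    simp only [hterm, ← Finset.mul_sum]
    exact (hl n).const_mul (c n)
  have hsquare := ((tendsto_alternating_harmonic.pow 2).div_const 2).congr fun N =>
    (sum_sum_eq_sq_div_two N).symm
  have hsum : Tendsto (fun N : ℕ => ∑ n ∈ Finset.range N, c n * l n) atTop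
      (nhds (Real.log 2 ^ 2 / 2)) := by
    refine tendsto_sum_of_abs_sub_le hsquare fun n N hnN => ?_
    have hc : |c n| = 1 / ((n : ℝ) + 1) := by
      rw [abs_div, abs_pow, abs_neg, abs_one, one_pow, abs_of_pos (by positivity)]
    simp only [hterm, ← Finset.mul_sum]
    rw [← mul_sub, abs_mul, hc, mul_comm]
    gcongr
    exact (hbound n N hnN).trans (div_sq_add_sq_le n N)
  refine ⟨fun n => c n * l n, fun n => c n * l n, hrow, fun k => (hrow k).congr fun N => ?_,
    hsum, hsum⟩
  refine Finset.sum_congr rfl fun n _ => ?_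
  rw [add_comm (n + 1) (k + 1), mul_comm ((k : ℝ) + 1)]
end

section
/- ∫_{-∞}^{∞} log(cos²x)/(1 + e^{2|x|}) dx = -(log 2)². -/
open MeasureTheory Real Filter

theorem hasSum_pow_mul_cos_div {q : ℝ} (hq : |q| < 1) (u : ℝ) :
    HasSum (fun k : ℕ => q ^ (k + 1) * cos ((k + 1) * u) / (k + 1))
      (-log (1 - 2 * q * cos u + q ^ 2) / 2) := by
  have hz : ‖(q : ℂ) * Complex.exp (u * Complex.I)‖ < 1 := by
    simpa [Complex.norm_exp_ofReal_mul_I] using hq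
  convert! Complex.hasSum_re (Complex.hasSum_taylorSeries_neg_log' hz) using 1
  · ext k
    have h : ((q : ℂ) * Complex.exp (u * Complex.I)) ^ (k + 1) / (k + 1)
        = ((q ^ (k + 1) / (k + 1) : ℝ) : ℂ) * Complex.exp (((k + 1) * u : ℝ) * Complex.I) := by
      rw [mul_pow, ← Complex.exp_nat_mul]
      push_cast
      ring_nf
    rw [h, Complex.re_ofReal_mul, Complex.exp_ofReal_mul_I_re]
    ring
  · rw [Complex.neg_re, Complex.log_re, Complex.norm_def, log_sqrt (Complex.normSq_nonneg _),
      neg_div]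
    congr 3
    rw [Complex.normSq_apply]
    simp [Complex.exp_ofReal_mul_I_re, Complex.exp_ofReal_mul_I_im]
    linear_combination (-q ^ 2) * sin_sq_add_cos_sq u

theorem hasSum_pow_mul_exp_neg {q u : ℝ} (hq : |q| ≤ 1) (hu : 0 < u) :
    HasSum (fun n : ℕ => (q * exp (-u)) ^ (n + 1)) (q * exp (-u) / (1 - q * exp (-u))) := by
  have h : |q * exp (-u)| < 1 := by
    rw [abs_mul, abs_exp]
    exact mul_lt_one_of_nonneg_of_lt_one_right hq (exp_pos _).le (by simpa using hu)
  simpa only [pow_succ', div_eq_mul_inv] using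
    (hasSum_geometric_of_abs_lt_one h).mul_left (q * exp (-u))

theorem integrableOn_exp_mul_cos_Ioi {a : ℝ} (ha : 0 < a) (b : ℝ) :
    IntegrableOn (fun x : ℝ => exp (-(a * x)) * cos (b * x)) (Set.Ioi 0) := by
  refine (exp_neg_integrableOn_Ioi 0 ha).mono' (by fun_prop) (.of_forall fun x => ?_)
  rw [norm_mul, norm_of_nonneg (exp_pos _).le, neg_mul]
  exact mul_le_of_le_one_right (exp_pos _).le (abs_cos_le_one _)

theorem integral_exp_mul_cos_Ioi {a : ℝ} (ha : 0 < a) (b : ℝ) :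
    ∫ x in Set.Ioi (0 : ℝ), exp (-(a * x)) * cos (b * x) = a / (a ^ 2 + b ^ 2) := by
  have hre : (-a + b * Complex.I : ℂ).re < 0 := by simpa using ha
  have h := integral_exp_mul_complex_Ioi hre 0
  have h' := integral_re (integrableOn_exp_mul_complex_Ioi hre 0)
  rw [h] at h'
  convert! h' using 1
  · congr 1
    ext x
    simp [Complex.exp_re]
  · simp [Complex.div_re, Complex.normSq_apply]
    field_simp

theorem integrableOn_exp_neg_mul_of_periodic {f : ℝ → ℝ} {T : ℝ} (hT : 0 < T)
    (hf : Function.Periodic f T) (hfi : ∀ a b, IntervalIntegrable f volume a b) :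
    IntegrableOn (fun x => f x * exp (-x)) (Set.Ioi 0) := by
  have hnorm : Function.Periodic (fun x => ‖f x‖) T := hf.comp norm
  have hle (n : ℕ) : n * T ≤ n * T + T := by linarith
  have hfn (n : ℕ) : IntegrableOn f (Set.Ioc (n * T) (n * T + T)) :=
    (intervalIntegrable_iff_integrableOn_Ioc_of_le (hle n)).1 (hfi _ _)
  have hbound (n : ℕ) (x : ℝ) (hx : x ∈ Set.Ioc (n * T) (n * T + T)) :
      ‖f x * exp (-x)‖ ≤ ‖f x‖ * exp (-T) ^ n := by
    rw [norm_mul, norm_of_nonneg (exp_pos _).le, ← exp_nat_mul]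
    gcongr
    linarith [hx.1]
  have hi (n : ℕ) : IntegrableOn (fun x => f x * exp (-x)) (Set.Ioc (n * T) (n * T + T)) := by
    refine ((hfn n).norm.mul_const (exp (-T) ^ n)).mono'
      ((hfn n).aestronglyMeasurable.mul (by fun_prop)) ?_
    filter_upwards [ae_restrict_mem measurableSet_Ioc] with x hx using hbound n x hx
  refine (integrableOn_iUnion_of_summable_integral_norm hi ?_).mono_set
    (t := ⋃ n : ℕ, Set.Ioc (n * T) (n * T + T)) fun x hx => ?_
  · have hgeom : Summable fun n : ℕ => (∫ x in (0 : ℝ)..0 + T, ‖f x‖) * exp (-T) ^ n :=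
      (summable_geometric_of_lt_one (exp_pos _).le (by simpa using hT)).mul_left _
    refine hgeom.of_nonneg_of_le (fun n => integral_nonneg fun x => norm_nonneg _) fun n => ?_
    calc ∫ x in Set.Ioc (n * T) (n * T + T), ‖f x * exp (-x)‖
        ≤ ∫ x in Set.Ioc (n * T) (n * T + T), ‖f x‖ * exp (-T) ^ n :=
          setIntegral_mono_on (hi n).norm ((hfn n).norm.mul_const _) measurableSet_Ioc (hbound n)
      _ = (∫ x in (0 : ℝ)..0 + T, ‖f x‖) * exp (-T) ^ n := by
          rw [integral_mul_const, ← intervalIntegral.integral_of_le (hle n),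
            hnorm.intervalIntegral_add_eq (n * T) 0]
  · have hx' : x ∈ ⋃ n : ℤ, Set.Ioc (n • T) ((n + 1) • T) := by
      rw [iUnion_Ioc_zsmul hT]; trivial
    obtain ⟨n, h1, h2⟩ := Set.mem_iUnion.1 hx'
    have hn : 0 ≤ n := by
      by_contra! hn
      have : (n + 1) • T ≤ 0 := by
        rw [zsmul_eq_mul]
        exact mul_nonpos_of_nonpos_of_nonneg (by exact_mod_cast hn) hT.le
      exact absurd hx (not_lt.2 (h2.trans this))
    lift n to ℕ using hn
    refine Set.mem_iUnion.2 ⟨n, ?_, ?_⟩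
    · simpa using h1
    · simpa [add_mul] using h2

theorem integral_Ioi_inv_one_add_exp :
    IntegrableOn (fun u : ℝ => 1 / (1 + exp u)) (Set.Ioi 0) ∧
    ∫ u in Set.Ioi (0 : ℝ), 1 / (1 + exp u) = log 2 := by
  have hd (u : ℝ) (_ : u ∈ Set.Ici 0) :
      HasDerivAt (fun u : ℝ => -log (1 + exp (-u))) (1 / (1 + exp u)) u := by
    convert! (((hasDerivAt_neg u).exp.const_add 1).log (by positivity)).neg using 1
    rw [exp_neg]
    field_simp
    ring
  have hl : Tendsto (fun u : ℝ => -log (1 + exp (-u))) atTop (nhds 0) := by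
    have h := (tendsto_exp_neg_atTop_nhds_zero.const_add 1).log (by norm_num)
    simpa using h.neg
  have hp (u : ℝ) (_ : u ∈ Set.Ioi 0) : 0 ≤ 1 / (1 + exp u) := by positivity
  refine ⟨integrableOn_Ioi_deriv_of_nonneg' hd hp hl, ?_⟩
  rw [integral_Ioi_of_hasDerivAt_of_nonneg' hd hp hl]
  norm_num

theorem sin_sq_le_one_sub_two_mul_cos (q u : ℝ) : sin u ^ 2 ≤ 1 - 2 * q * cos u + q ^ 2 := by
  nlinarith [sin_sq_add_cos_sq u, sq_nonneg (q - cos u)]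

theorem ae_sin_ne_zero : ∀ᵐ u : ℝ, sin u ≠ 0 := by
  have h : {u : ℝ | sin u = 0}.Countable := by
    convert! Set.countable_range (fun n : ℤ => (n : ℝ) * π) using 1
    ext u
    simp [sin_eq_zero_iff]
  exact h.ae_notMem volume

theorem integral_log_mul_div_of_abs_lt_one {q : ℝ} (hq : |q| < 1) :
    ∫ u in Set.Ioi (0 : ℝ),
      log (1 - 2 * q * cos u + q ^ 2) * (q * exp (-u) / (1 - q * exp (-u)))
      = -log (1 - q) ^ 2 := by
  let F (p : ℕ × ℕ) (u : ℝ) : ℝ :=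
    q ^ (p.1 + 1) * cos ((p.1 + 1) * u) / (p.1 + 1) * (q * exp (-u)) ^ (p.2 + 1)
  have hF (p : ℕ × ℕ) : F p = fun u => q ^ (p.1 + 1) / (p.1 + 1) * q ^ (p.2 + 1) *
      (exp (-((p.2 + 1 : ℝ) * u)) * cos ((p.1 + 1 : ℝ) * u)) := by
    ext u
    simp only [F, mul_pow, ← exp_nat_mul]
    push_cast
    ring_nf
  have hpos (n : ℕ) : (0 : ℝ) < n + 1 := by positivity
  have hFi (p : ℕ × ℕ) : IntegrableOn (F p) (Set.Ioi 0) := by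
    rw [hF]
    exact (integrableOn_exp_mul_cos_Ioi (hpos p.2) _).const_mul _
  have hgeom : Summable fun n : ℕ => |q| ^ (n + 1) :=
    (summable_nat_add_iff 1).2 (summable_geometric_of_lt_one (abs_nonneg q) hq)
  have hgeom2 : Summable fun p : ℕ × ℕ => |q| ^ (p.1 + 1) * |q| ^ (p.2 + 1) :=
    hgeom.mul_of_nonneg hgeom (fun _ => by positivity) (fun _ => by positivity)
  have hnorm (p : ℕ × ℕ) (u : ℝ) : ‖F p u‖ ≤ |q| ^ (p.1 + 1) * |q| ^ (p.2 + 1) *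
      exp (-((p.2 + 1 : ℝ) * u)) := by
    rw [hF]
    simp only [norm_mul, norm_div, norm_pow, norm_eq_abs, abs_exp, abs_of_pos (hpos p.1)]
    have h1 := abs_cos_le_one ((p.1 + 1 : ℝ) * u)
    have h2 : |q| ^ (p.1 + 1) / (p.1 + 1 : ℝ) ≤ |q| ^ (p.1 + 1) :=
      div_le_self (by positivity) (by simp)
    calc _ ≤ |q| ^ (p.1 + 1) * |q| ^ (p.2 + 1) * (exp (-((p.2 + 1 : ℝ) * u)) * 1) := by gcongr
      _ = _ := by ring
  have hFs : Summable fun p => ∫ u in Set.Ioi (0 : ℝ), ‖F p u‖ := by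
    refine hgeom2.of_nonneg_of_le (fun p => integral_nonneg fun u => norm_nonneg _) fun p => ?_
    have he := exp_neg_integrableOn_Ioi 0 (hpos p.2)
    simp only [neg_mul] at he
    have hint : ∫ u in Set.Ioi (0 : ℝ), exp (-((p.2 + 1 : ℝ) * u)) = 1 / (p.2 + 1) := by
      simpa only [neg_mul, mul_zero, neg_zero, exp_zero, neg_div_neg_eq] using
        integral_exp_mul_Ioi (neg_lt_zero.2 (hpos p.2)) 0
    calc ∫ u in Set.Ioi (0 : ℝ), ‖F p u‖
        ≤ ∫ u in Set.Ioi (0 : ℝ), |q| ^ (p.1 + 1) * |q| ^ (p.2 + 1) *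
            exp (-((p.2 + 1 : ℝ) * u)) :=
          integral_mono (hFi p).norm (he.const_mul _) (hnorm p)
      _ = |q| ^ (p.1 + 1) * |q| ^ (p.2 + 1) / (p.2 + 1) := by
          rw [integral_const_mul, hint]; ring
      _ ≤ _ := div_le_self (by positivity) (by simp)
  have hsum := hasSum_integral_of_summable_integral_norm hFi hFs
  have hval (p : ℕ × ℕ) : ∫ u in Set.Ioi (0 : ℝ), F p u =
      q ^ (p.1 + 1) / (p.1 + 1) * q ^ (p.2 + 1) *
        ((p.2 + 1) / ((p.2 + 1) ^ 2 + (p.1 + 1) ^ 2)) := by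
    rw [hF, integral_const_mul, integral_exp_mul_cos_Ioi (hpos p.2)]
  simp only [hval] at hsum
  have hswap := (Equiv.prodComm ℕ ℕ).hasSum_iff.2 hsum
  have hlog := hasSum_pow_div_log_of_abs_lt_one hq
  have hprod := (hlog.mul_eq hlog (u := _) (by
    convert! hsum.add hswap using 1
    ext p
    have := hpos p.1
    have := hpos p.2
    simp only [Function.comp, Equiv.prodComm_apply, Prod.fst_swap, Prod.snd_swap]
    field_simp
    ring))
  have hpt : ∫ u in Set.Ioi (0 : ℝ), ∑' p, F p u = ∫ u in Set.Ioi (0 : ℝ), -(1 / 2) *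
      (log (1 - 2 * q * cos u + q ^ 2) * (q * exp (-u) / (1 - q * exp (-u)))) := by
    refine setIntegral_congr_fun measurableSet_Ioi fun u hu => ?_
    have hs : Summable fun p => F p u := by
      refine Summable.of_norm_bounded hgeom2 fun p => (hnorm p u).trans ?_
      refine mul_le_of_le_one_right (by positivity) (exp_le_one_iff.2 ?_)
      have := mul_pos (hpos p.2) hu
      linarith
    rw [((hasSum_pow_mul_cos_div hq u).mul (hasSum_pow_mul_exp_neg hq.le hu) hs).tsum_eq]
    ring
  rw [hpt, integral_const_mul] at hprod
  linear_combination hprod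

theorem integral_log_two_add_two_mul_cos_div :
    IntegrableOn (fun u : ℝ => log (2 + 2 * cos u) * (1 / (1 + exp u))) (Set.Ioi 0) ∧
    ∫ u in Set.Ioi (0 : ℝ), log (2 + 2 * cos u) * (1 / (1 + exp u)) = log 2 ^ 2 := by
  let f (u : ℝ) : ℝ := log 4 + |log (sin u ^ 2)|
  have hbi : IntegrableOn (fun u => f u * exp (-u)) (Set.Ioi 0) := by
    refine integrableOn_exp_neg_mul_of_periodic (T := 2 * π) (by positivity)
      (fun u => by simp [f]) fun a b => ?_
    have h : IntervalIntegrable (fun u => 2 * log (sin u)) volume a b :=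
      intervalIntegrable_log_sin.const_mul 2
    simpa [f, log_pow] using intervalIntegrable_const.add h.abs
  have hlogbound {q u : ℝ} (hq : |q| ≤ 1) (hu : sin u ≠ 0) :
      |log (1 - 2 * q * cos u + q ^ 2)| ≤ f u := by
    have h0 : 0 < sin u ^ 2 := by positivity
    have h1 := sin_sq_le_one_sub_two_mul_cos q u
    have h2 : 1 - 2 * q * cos u + q ^ 2 ≤ 4 := by
      have h3 : |q * cos u| ≤ 1 := by
        rw [abs_mul]; exact mul_le_one₀ hq (abs_nonneg _) (abs_cos_le_one u)
      have h4 : q ^ 2 ≤ 1 := (sq_le_one_iff_abs_le_one q).2 hq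
      linarith [neg_le_of_abs_le h3]
    have h5 : 0 ≤ log 4 := log_nonneg (by norm_num)
    have h6 := log_le_log h0 h1
    have h7 := log_le_log (h0.trans_le h1) h2
    rw [abs_le]
    constructor
    · linarith [neg_abs_le (log (sin u ^ 2))]
    · linarith [abs_nonneg (log (sin u ^ 2))]
  have hbound {q u : ℝ} (hq : -1 ≤ q) (hq0 : q ≤ 0) (hu : sin u ≠ 0) :
      ‖log (1 - 2 * q * cos u + q ^ 2) * (q * exp (-u) / (1 - q * exp (-u)))‖
        ≤ f u * exp (-u) := by
    have hq1 : |q| ≤ 1 := abs_le.2 ⟨hq, hq0.trans zero_le_one⟩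
    have h1 : 1 ≤ 1 - q * exp (-u) := by
      linarith [mul_nonpos_of_nonpos_of_nonneg hq0 (exp_pos (-u)).le]
    have h2 : ‖q * exp (-u) / (1 - q * exp (-u))‖ ≤ exp (-u) := by
      rw [norm_div, norm_of_nonneg (zero_le_one.trans h1), norm_mul,
        norm_of_nonneg (exp_pos (-u)).le]
      exact (div_le_self (by positivity) h1).trans
        (mul_le_of_le_one_left (exp_pos _).le hq1)
    rw [norm_mul]
    exact mul_le_mul (hlogbound hq1 hu) h2 (norm_nonneg _) ((abs_nonneg _).trans (hlogbound hq1 hu))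
  have heq : (fun u : ℝ => log (2 + 2 * cos u) * (1 / (1 + exp u))) = fun u =>
      -(log (1 - 2 * (-1) * cos u + (-1) ^ 2) * (-1 * exp (-u) / (1 - -1 * exp (-u)))) := by
    ext u
    have h : -1 * exp (-u) / (1 - -1 * exp (-u)) = -(1 / (1 + exp u)) := by
      rw [exp_neg]
      field_simp
      rw [sub_neg_eq_add, add_comm (1 : ℝ), div_self (by positivity)]
    rw [h]
    ring_nf
  have hae : ∀ᵐ u ∂volume.restrict (Set.Ioi (0 : ℝ)), sin u ≠ 0 := ae_restrict_of_ae ae_sin_ne_zero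
  have hmeas (q : ℝ) : Measurable fun u : ℝ =>
      log (1 - 2 * q * cos u + q ^ 2) * (q * exp (-u) / (1 - q * exp (-u))) := by fun_prop
  have hnear : ∀ᶠ q in nhdsWithin (-1 : ℝ) (Set.Ioi (-1)), q ∈ Set.Ioo (-1 : ℝ) 0 :=
    Ioo_mem_nhdsGT (by norm_num)
  have hlim := tendsto_integral_filter_of_dominated_convergence
    (μ := volume.restrict (Set.Ioi (0 : ℝ))) (l := nhdsWithin (-1 : ℝ) (Set.Ioi (-1)))
    (F := fun q u => log (1 - 2 * q * cos u + q ^ 2) * (q * exp (-u) / (1 - q * exp (-u))))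
    (f := fun u => log (1 - 2 * (-1) * cos u + (-1) ^ 2) * (-1 * exp (-u) / (1 - -1 * exp (-u))))
    (fun u => f u * exp (-u)) (.of_forall fun q => (hmeas q).aestronglyMeasurable)
    (hnear.mono fun q hq => hae.mono fun u hu => hbound hq.1.le hq.2.le hu) hbi
    (hae.mono fun u hu => by
      refine Tendsto.mono_left (ContinuousAt.tendsto (f := fun q : ℝ =>
        log (1 - 2 * q * cos u + q ^ 2) * (q * exp (-u) / (1 - q * exp (-u)))) ?_)
        nhdsWithin_le_nhds
      have h1 : 1 - 2 * (-1) * cos u + (-1) ^ 2 ≠ 0 :=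
        ((by positivity : 0 < sin u ^ 2).trans_le (sin_sq_le_one_sub_two_mul_cos (-1) u)).ne'
      have h2 : 1 - -1 * exp (-u) ≠ 0 := by linarith [exp_pos (-u)]
      fun_prop (disch := assumption))
  rw [heq]
  constructor
  · exact (hbi.mono' (hmeas (-1)).aestronglyMeasurable
      (hae.mono fun u hu => hbound le_rfl (by norm_num) hu)).neg
  · rw [integral_neg, neg_eq_iff_eq_neg]
    refine tendsto_nhds_unique hlim ?_
    have hc : ContinuousAt (fun q : ℝ => -log (1 - q) ^ 2) (-1) := by
      have : (1 : ℝ) - -1 ≠ 0 := by norm_num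
      fun_prop (disch := assumption)
    have ht := hc.tendsto.mono_left (nhdsWithin_le_nhds (s := Set.Ioi (-1)))
    rw [show (1 : ℝ) - -1 = 2 by norm_num] at ht
    refine ht.congr' (hnear.mono fun q hq => ?_)
    exact (integral_log_mul_div_of_abs_lt_one (abs_lt.2 ⟨hq.1, hq.2.trans one_pos⟩)).symm

/-- `∫_ℝ log(cos² x)/(1 + e^{2|x|}) dx = -(log 2)²`. -/
theorem integral_log_cos_sq_div_one_add_exp :
    ∫ x : ℝ, Real.log (Real.cos x ^ 2) / (1 + Real.exp (2 * |x|)) = -(Real.log 2 ^ 2) := by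
  have habs := integral_comp_abs (f := fun x => log (cos x ^ 2) / (1 + exp (2 * x)))
  simp only [cos_abs] at habs
  have hscale := integral_comp_mul_left_Ioi'
    (fun u => log ((2 + 2 * cos u) / 4) / (1 + exp u)) 0 (two_pos (α := ℝ))
  have hcos (x : ℝ) : (2 + 2 * cos (2 * x)) / 4 = cos x ^ 2 := by
    rw [cos_two_mul]; ring
  simp only [hcos, smul_eq_mul, mul_zero] at hscale
  obtain ⟨hi1, h1⟩ := integral_log_two_add_two_mul_cos_div
  obtain ⟨hi2, h2⟩ := integral_Ioi_inv_one_add_exp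
  rw [habs, hscale]
  calc ∫ u in Set.Ioi (0 : ℝ), log ((2 + 2 * cos u) / 4) / (1 + exp u)
      = ∫ u in Set.Ioi (0 : ℝ),
          (log (2 + 2 * cos u) * (1 / (1 + exp u)) - log 4 * (1 / (1 + exp u))) := by
        refine integral_congr_ae ((ae_restrict_of_ae ae_sin_ne_zero).mono fun u hu => ?_)
        have h0 : 2 + 2 * cos u ≠ 0 := fun h => by
          have : cos u = -1 := by linarith
          exact hu (pow_eq_zero_iff two_ne_zero |>.1 (by rw [sin_sq, this]; norm_num))
        simp only
        rw [log_div h0 (by norm_num)]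
        ring
    _ = log 2 ^ 2 - log 4 * log 2 := by
        rw [integral_sub hi1 (hi2.const_mul _), integral_const_mul, h1, h2]
    _ = -(log 2 ^ 2) := by
        rw [show (4 : ℝ) = 2 ^ 2 by norm_num, log_pow]
        push_cast
        ring
end

section
/- Let a > 0. The 2π-periodic function g(x) = 1/(cosh a − cos x) has exponential Fourier coefficients C_n(g) = e^{-|n|a}/sinh a for all n ∈ ℤ. -/
open MeasureTheory Real Filter

/-- The Fourier coefficients of `1/(cosh a − cos t)` with nonpositive index, computed by applying
the Cauchy integral formula to `z ^ m / (e^a - z)` on the unit disc. -/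
lemma integral_inv_cosh_sub_cos_mul_exp_nat (a : ℝ) (ha : 0 < a) (m : ℕ) :
    ∫ t in (0 : ℝ)..(2 * π),
        (((Real.cosh a - Real.cos t)⁻¹ : ℝ) : ℂ) * Complex.exp (Complex.I * (m : ℂ) * (t : ℂ)) =
      2 * π * Complex.exp (-(m : ℂ) * a) / Complex.sinh a := by
  have norm_r : ‖Complex.exp (-(a : ℂ))‖ < 1 := by
    rw [Complex.norm_exp]; simpa using ha
  have one_lt : 1 < ‖Complex.exp (a : ℂ)‖ := by
    rw [Complex.norm_exp]; simpa using ha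
  have diff : DifferentiableOn ℂ
      (fun z : ℂ => 2 * z ^ m / (Complex.I * (Complex.exp a - z))) (Metric.closedBall 0 1) := by
    intro z hz
    have hz' : ‖z‖ ≤ 1 := by simpa using hz
    have hne : Complex.I * (Complex.exp a - z) ≠ 0 := by
      refine mul_ne_zero Complex.I_ne_zero (sub_ne_zero.2 ?_)
      rintro h
      rw [h] at one_lt
      linarith
    fun_prop (disch := exact hne)
  have cauchy := diff.circleIntegral_sub_inv_smul (w := Complex.exp (-(a : ℂ)))
    (by simpa using norm_r)
  have sinh_ne : Complex.sinh a ≠ 0 := by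
    rw [← Complex.ofReal_sinh]
    exact_mod_cast (Real.sinh_pos_iff.2 ha).ne'
  have sinh_eq : Complex.exp a - Complex.exp (-(a : ℂ)) = 2 * Complex.sinh a := by
    rw [Complex.sinh]; ring
  calc
    _ = ∮ z in C(0, 1), (z - Complex.exp (-(a : ℂ)))⁻¹ •
          (2 * z ^ m / (Complex.I * (Complex.exp a - z))) := by
      rw [circleIntegral]
      refine intervalIntegral.integral_congr fun t _ => ?_
      have hz : ‖Complex.exp (t * Complex.I)‖ = 1 := Complex.norm_exp_ofReal_mul_I t
      have hpow : Complex.exp (Complex.I * m * t) = Complex.exp (t * Complex.I) ^ m := by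
        rw [← Complex.exp_nat_mul]; ring_nf
      have hcos : Complex.cos t =
          (Complex.exp (t * Complex.I) + (Complex.exp (t * Complex.I))⁻¹) / 2 := by
        rw [Complex.cos, ← Complex.exp_neg, neg_mul]
      have hcosh : Complex.cosh a = (Complex.exp a + (Complex.exp a)⁻¹) / 2 := by
        rw [Complex.cosh, ← Complex.exp_neg]
      simp only [deriv_circleMap, circleMap, Complex.ofReal_one, one_mul, zero_add, smul_eq_mul,
        Complex.ofReal_inv, Complex.ofReal_sub, Complex.ofReal_cosh, Complex.ofReal_cos]
      rw [hpow, hcos, hcosh]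
      have h1 : Complex.exp a - Complex.exp (t * Complex.I) ≠ 0 := by
        refine sub_ne_zero.2 fun h => ?_
        rw [h] at one_lt
        linarith
      have h2 : Complex.exp (t * Complex.I) - Complex.exp (-(a : ℂ)) ≠ 0 := by
        refine sub_ne_zero.2 fun h => ?_
        rw [← h] at norm_r
        linarith
      rw [Complex.exp_neg] at h2 ⊢
      have hE := Complex.exp_ne_zero (a : ℂ)
      have hZ := Complex.exp_ne_zero (t * Complex.I)
      generalize Complex.exp (t * Complex.I) = z at *
      generalize Complex.exp (a : ℂ) = E at *
      have key : (E + E⁻¹) / 2 - (z + z⁻¹) / 2 = (z - E⁻¹) * (E - z) / (2 * z) := by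
        field_simp
        ring
      rw [key]
      generalize z - E⁻¹ = u at *
      generalize E - z = v at *
      have hI := Complex.I_ne_zero
      field_simp
    _ = _ := by
      rw [cauchy, smul_eq_mul, sinh_eq, ← Complex.exp_nat_mul, neg_mul, mul_neg]
      have hI := Complex.I_ne_zero
      field_simp

/-- For `a > 0`, the `2π`-periodic function `g(x) = 1/(cosh a − cos x)` has Fourier
coefficients `Cₙ(g) = e^{-|n|a}/sinh a` for all `n ∈ ℤ`. -/
theorem fourier_coeff_inv_cosh_sub_cos (a : ℝ) (ha : 0 < a) :
    ∀ n : ℤ,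
      (((2 * π)⁻¹ : ℝ) : ℂ) *
          ∫ t in (0 : ℝ)..(2 * π),
            (((Real.cosh a - Real.cos t)⁻¹ : ℝ) : ℂ) *
              Complex.exp (-Complex.I * (n : ℂ) * (t : ℂ)) =
        ((Real.exp (-(|n| : ℝ) * a) / Real.sinh a : ℝ) : ℂ) := by
  intro n
  obtain ⟨k, hn⟩ := n.eq_nat_or_neg
  have hpi : (π : ℂ) ≠ 0 := by exact_mod_cast Real.pi_ne_zero
  suffices h : ∫ t in (0 : ℝ)..(2 * π), (((Real.cosh a - Real.cos t)⁻¹ : ℝ) : ℂ) *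
      Complex.exp (-Complex.I * (n : ℂ) * (t : ℂ)) =
      2 * π * Complex.exp (-(k : ℂ) * a) / Complex.sinh a by
    have habs : |(n : ℝ)| = k := by rcases hn with rfl | rfl <;> simp
    rw [h, habs]
    push_cast
    field_simp
  rw [← integral_inv_cosh_sub_cos_mul_exp_nat a ha]
  obtain rfl | rfl := hn
  · have reflect := intervalIntegral.integral_comp_sub_left (a := 0) (b := 2 * π)
      (fun t : ℝ => (((Real.cosh a - Real.cos t)⁻¹ : ℝ) : ℂ) *
        Complex.exp (Complex.I * (k : ℂ) * (t : ℂ))) (2 * π)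
    rw [sub_self, sub_zero] at reflect
    rw [← reflect]
    refine intervalIntegral.integral_congr fun t _ => ?_
    have hexp : Complex.exp (Complex.I * k * ((2 * π - t : ℝ) : ℂ)) =
        Complex.exp (-Complex.I * k * t) := by
      rw [Complex.exp_eq_exp_iff_exists_int]
      exact ⟨k, by push_cast; ring⟩
    simp only [hexp, Int.cast_natCast, Real.cos_two_pi_sub]
  · simp only [Int.cast_neg, Int.cast_natCast, neg_mul_neg]
end

section
/- For all positive real numbers a and b, ∫_ℝ e^{-x²/(4b)}/(cosh a − cos x) dx = (2√(πb)/sinh a)·(1 + 2·Σ_{n=1}^{∞} e^{-an − bn²}). -/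
open MeasureTheory Real Filter

/-- The Fourier cosine series of the Poisson kernel, in hyperbolic form. -/
theorem hasSum_exp_neg_mul_cos {a : ℝ} (ha : 0 < a) (x : ℝ) :
    HasSum (fun n : ℕ ↦ Real.exp (-a * ((n : ℝ) + 1)) * Real.cos (((n : ℝ) + 1) * x))
      ((Real.sinh a / (Real.cosh a - Real.cos x) - 1) / 2) := by
  set z : ℂ := Complex.exp (-a + x * Complex.I) with hz
  have hre : z.re = Real.exp (-a) * Real.cos x := by simp [hz, Complex.exp_re]
  have him : z.im = Real.exp (-a) * Real.sin x := by simp [hz, Complex.exp_im]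
  have hnorm : ‖z‖ < 1 := by simp [hz, Complex.norm_exp, ha]
  convert Complex.hasSum_re ((hasSum_geometric_of_norm_lt_one hnorm).mul_left z) using 1
  · ext n
    have : z * z ^ n =
        Complex.exp ((-a * ((n : ℝ) + 1) : ℝ) + (((n : ℝ) + 1) * x : ℝ) * Complex.I) := by
      rw [← pow_succ', hz, ← Complex.exp_nat_mul]
      congr 1
      push_cast
      ring
    rw [this, Complex.exp_re]
    simp
  · have hr : 0 < Real.exp (-a) := Real.exp_pos _
    have hr1 : Real.exp (-a) < 1 := by simpa using ha
    have hinv : Real.exp a = (Real.exp (-a))⁻¹ := by rw [Real.exp_neg, inv_inv]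
    rw [Complex.mul_re, Complex.inv_re, Complex.inv_im, Complex.normSq_apply, Real.sinh_eq,
      Real.cosh_eq, hinv]
    simp only [Complex.sub_re, Complex.sub_im, Complex.one_re, Complex.one_im, hre, him]
    generalize Real.exp (-a) = r at *
    have hsin : Real.sin x ^ 2 = 1 - Real.cos x ^ 2 := Real.sin_sq x
    have hcos := Real.cos_le_one x
    generalize Real.cos x = c at *
    generalize Real.sin x = s at *
    have hpos : 0 < 1 + r ^ 2 - 2 * r * c := by nlinarith [mul_nonneg hr.le (sub_nonneg.2 hcos)]
    have hden : (1 - r * c) * (1 - r * c) + (0 - r * s) * (0 - r * s) = 1 + r ^ 2 - 2 * r * c := by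
      linear_combination r ^ 2 * hsin
    have hden' : (r⁻¹ + r) / 2 - c = (1 + r ^ 2 - 2 * r * c) / (2 * r) := by
      field_simp
    rw [hden, hden']
    generalize hD : 1 + r ^ 2 - 2 * r * c = D at *
    have := hpos.ne'
    field_simp
    linear_combination 2 * r ^ 2 * hsin + hD

theorem integrable_exp_neg_sq_div {b : ℝ} (hb : 0 < b) :
    Integrable fun x : ℝ ↦ Real.exp (-x ^ 2 / (4 * b)) := by
  convert integrable_exp_neg_mul_sq (b := (4 * b)⁻¹) (by positivity) using 3
  ring

/-- The Fourier cosine transform of a Gaussian. -/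
theorem integral_exp_neg_sq_div_mul_cos {b : ℝ} (hb : 0 < b) (t : ℝ) :
    ∫ x : ℝ, Real.exp (-x ^ 2 / (4 * b)) * Real.cos (t * x) =
      2 * Real.sqrt (π * b) * Real.exp (-b * t ^ 2) := by
  have hpos : 0 < (((4 * b)⁻¹ : ℝ) : ℂ).re := by
    rw [Complex.ofReal_re]
    positivity
  have hint : Integrable fun x : ℝ ↦
      Complex.exp (Complex.I * t * x) * Complex.exp (-((4 * b)⁻¹ : ℝ) * x ^ 2) := by
    convert integrable_cexp_quadratic hpos (Complex.I * t) 0 using 2 with x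
    rw [← Complex.exp_add]
    ring_nf
  have hre := congrArg Complex.re (fourierIntegral_gaussian hpos t)
  rw [← RCLike.re_eq_complex_re, ← integral_re hint, RCLike.re_eq_complex_re] at hre
  convert hre using 1
  · congr with x
    have : Complex.exp (Complex.I * t * x) * Complex.exp (-((4 * b)⁻¹ : ℝ) * x ^ 2) =
        Complex.exp ((-x ^ 2 / (4 * b) : ℝ) + (t * x : ℝ) * Complex.I) := by
      rw [← Complex.exp_add]
      congr 1
      push_cast
      ring
    rw [this, Complex.exp_add, ← Complex.ofReal_exp, Complex.re_ofReal_mul,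
      Complex.exp_ofReal_mul_I_re]
  · have hroot : 2 * Real.sqrt (π * b) = (π / (4 * b)⁻¹) ^ (1 / 2 : ℝ) := by
      rw [← Real.sqrt_eq_rpow, div_inv_eq_mul, show π * (4 * b) = 2 ^ 2 * (π * b) by ring,
        Real.sqrt_mul (x := 2 ^ 2) (by positivity), Real.sqrt_sq (by norm_num)]
    have hexp : -b * t ^ 2 = -t ^ 2 / (4 * (4 * b)⁻¹) := by
      field_simp
    rw [hroot, hexp, ← Complex.ofReal_re (_ * _), Complex.ofReal_mul,
      Complex.ofReal_cpow (by positivity)]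
    push_cast
    rfl

/-- For `a, b > 0`,
`∫_ℝ e^{-x²/(4b)}/(cosh a − cos x) dx = (2√(πb)/sinh a)(1 + 2 ∑_{n ≥ 1} e^{-an - bn²})`. -/
theorem integral_gaussian_div_cosh_sub_cos (a b : ℝ) (ha : 0 < a) (hb : 0 < b) :
    ∫ x : ℝ, Real.exp (-x ^ 2 / (4 * b)) / (Real.cosh a - Real.cos x) =
      2 * Real.sqrt (π * b) / Real.sinh a *
        (1 + 2 * ∑' n : ℕ, Real.exp (-a * ((n : ℝ) + 1) - b * ((n : ℝ) + 1) ^ 2)) := by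
  have hsinh : 0 < Real.sinh a := Real.sinh_pos_iff.2 ha
  have hcosh : 1 < Real.cosh a := Real.one_lt_cosh.2 ha.ne'
  have hG := integrable_exp_neg_sq_div hb
  have hQ : Integrable fun x : ℝ ↦
      Real.exp (-x ^ 2 / (4 * b)) / (Real.cosh a - Real.cos x) := by
    refine (hG.div_const (Real.cosh a - 1)).mono'
      (by fun_prop : Measurable _).aestronglyMeasurable (.of_forall fun x ↦ ?_)
    have := Real.cos_le_one x
    rw [Real.norm_of_nonneg (div_nonneg (Real.exp_pos _).le (by linarith))]
    gcongr
  set F : ℕ → ℝ → ℝ := fun n x ↦ Real.exp (-a * ((n : ℝ) + 1)) *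
    (Real.exp (-x ^ 2 / (4 * b)) * Real.cos (((n : ℝ) + 1) * x)) with hF
  have hF_int (n : ℕ) : Integrable (F n) := by
    refine (hG.mono (by fun_prop : Measurable _).aestronglyMeasurable
      (.of_forall fun x ↦ ?_)).const_mul _
    rw [norm_mul]
    exact mul_le_of_le_one_right (norm_nonneg _) (Real.abs_cos_le_one _)
  have hF_sum : Summable fun n ↦ ∫ x, ‖F n x‖ := by
    have hs : Summable fun n : ℕ ↦ Real.exp (-a * ((n : ℝ) + 1)) := by
      simpa using (hasSum_exp_neg_mul_cos ha 0).summable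
    refine (hs.mul_right (∫ x : ℝ, Real.exp (-x ^ 2 / (4 * b)))).of_nonneg_of_le
      (fun n ↦ integral_nonneg fun x ↦ norm_nonneg _) fun n ↦ ?_
    rw [← integral_const_mul]
    refine integral_mono (hF_int n).norm (hG.const_mul _) fun x ↦ ?_
    simp only [hF, norm_mul, Real.norm_eq_abs, Real.abs_exp]
    gcongr
    exact mul_le_of_le_one_right (Real.exp_pos _).le (Real.abs_cos_le_one _)
  have hpt (x : ℝ) : ∑' n, F n x = (Real.sinh a *
      (Real.exp (-x ^ 2 / (4 * b)) / (Real.cosh a - Real.cos x)) -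
        Real.exp (-x ^ 2 / (4 * b))) / 2 := by
    convert ((hasSum_exp_neg_mul_cos ha x).mul_left (Real.exp (-x ^ 2 / (4 * b)))).tsum_eq using 1
    · exact tsum_congr fun n ↦ by simp only [hF]; ring
    · ring
  have hG0 : ∫ x : ℝ, Real.exp (-x ^ 2 / (4 * b)) = 2 * Real.sqrt (π * b) := by
    simpa using integral_exp_neg_sq_div_mul_cos hb 0
  have hFn (n : ℕ) : ∫ x, F n x = 2 * Real.sqrt (π * b) *
      Real.exp (-a * ((n : ℝ) + 1) - b * ((n : ℝ) + 1) ^ 2) := by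
    simp only [hF]
    rw [integral_const_mul, integral_exp_neg_sq_div_mul_cos hb, sub_eq_add_neg, Real.exp_add,
      neg_mul b]
    ring
  have key := (hasSum_integral_of_summable_integral_norm hF_int hF_sum).tsum_eq
  simp_rw [hpt, hFn] at key
  rw [tsum_mul_left, integral_div, integral_sub (hQ.const_mul _) hG, integral_const_mul,
    hG0] at key
  rw [div_mul_eq_mul_div, eq_div_iff hsinh.ne']
  linear_combination -2 * key
end

section
/- For q ≥ 1 and k ≥ 1, define R_q(k) = ((-1)^k/k)·Σ_{n=q}^{∞} (-1)^n·n/(n² + k²). Then |R_q(k)| ≤ (1/k)·q/(k² + q²) for all k, q ≥ 1, and ε_q := Σ_{k=1}^{∞} R_q(k) satisfies lim_{q→∞} ε_q = 0. -/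
open MeasureTheory Real Filter

/-- An alternating series whose terms are eventually decreasing to `0` converges. -/
lemma exists_tendsto_alternating_of_antitone_shift {f : ℕ → ℝ} (k : ℕ)
    (hf : Antitone fun i => f (k + i)) (h0 : Tendsto f atTop (nhds 0)) :
    ∃ l, Tendsto (fun N => ∑ n ∈ Finset.range N, (-1 : ℝ) ^ n * f n) atTop (nhds l) := by
  have h0' : Tendsto (fun i => f (k + i)) atTop (nhds 0) := by
    simpa only [add_comm k] using (tendsto_add_atTop_iff_nat k).2 h0
  obtain ⟨l, hl⟩ := hf.tendsto_alternating_series_of_tendsto_zero h0'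
  refine ⟨∑ n ∈ Finset.range k, (-1 : ℝ) ^ n * f n + (-1) ^ k * l,
    (tendsto_add_atTop_iff_nat k).1 ?_⟩
  refine ((hl.const_mul ((-1 : ℝ) ^ k)).const_add _).congr fun N => ?_
  rw [add_comm N k, Finset.sum_range_add, Finset.mul_sum]
  simp only [pow_add, mul_assoc]

/-- The terms `n / (n² + k²)`. -/
noncomputable def ratTerm (k n : ℕ) : ℝ := (n : ℝ) / ((n : ℝ) ^ 2 + (k : ℝ) ^ 2)

lemma ratTerm_nonneg (k n : ℕ) : 0 ≤ ratTerm k n := by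
  unfold ratTerm; positivity

lemma ratTerm_le_one_div (k n : ℕ) : ratTerm k n ≤ 1 / (n : ℝ) := by
  rcases Nat.eq_zero_or_pos n with rfl | hn
  · simp [ratTerm]
  · have : (0 : ℝ) < n := by exact_mod_cast hn
    unfold ratTerm
    rw [div_le_div_iff₀ (by positivity) this]
    nlinarith [sq_nonneg (k : ℝ)]

lemma ratTerm_le_one_div_left {k : ℕ} (hk : 1 ≤ k) (n : ℕ) : ratTerm k n ≤ 1 / (k : ℝ) := by
  have : (0 : ℝ) < k := by exact_mod_cast hk
  unfold ratTerm
  rw [div_le_div_iff₀ (by positivity) this]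
  nlinarith [sq_nonneg ((k : ℝ) - n), sq_nonneg ((k : ℝ) + n)]

lemma tendsto_ratTerm (k : ℕ) : Tendsto (ratTerm k) atTop (nhds 0) :=
  squeeze_zero (ratTerm_nonneg k) (ratTerm_le_one_div k) tendsto_one_div_atTop_nhds_zero_nat

lemma antitone_ratTerm_shift {k : ℕ} (hk : 1 ≤ k) : Antitone fun i => ratTerm k (k + i) := by
  refine antitone_nat_of_succ_le fun i => ?_
  have : (0 : ℝ) < k := by exact_mod_cast hk
  have hi : (0 : ℝ) ≤ i := by positivity
  unfold ratTerm
  push_cast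
  rw [div_le_div_iff₀ (by positivity) (by positivity)]
  nlinarith [mul_nonneg hi this.le, mul_nonneg hi hi, mul_pos this this,
    mul_nonneg (mul_nonneg hi this.le) this.le, mul_nonneg (mul_nonneg hi hi) this.le]

/-- A minorant of the alternating tails of `ratTerm k`. -/
noncomputable def tailMinorant (k q : ℕ) : ℝ :=
  ((q : ℝ) - 1) / (2 * ((q : ℝ) ^ 2 - q + (k : ℝ) ^ 2))

lemma tailMinorant_nonneg (k : ℕ) {q : ℕ} (hq : 1 ≤ q) : 0 ≤ tailMinorant k q := by
  have : (1 : ℝ) ≤ q := by exact_mod_cast hq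
  unfold tailMinorant
  exact div_nonneg (by linarith) (by nlinarith [sq_nonneg (k : ℝ)])

lemma tendsto_tailMinorant (k : ℕ) : Tendsto (tailMinorant k) atTop (nhds 0) := by
  refine squeeze_zero' (eventually_atTop.2 ⟨1, fun q hq => tailMinorant_nonneg k hq⟩)
    (eventually_atTop.2 ⟨2, fun q hq => ?_⟩) tendsto_one_div_atTop_nhds_zero_nat
  have : (2 : ℝ) ≤ q := by exact_mod_cast hq
  unfold tailMinorant
  rw [div_le_div_iff₀ (by nlinarith [sq_nonneg (k : ℝ)]) (by linarith)]
  nlinarith [sq_nonneg (k : ℝ)]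

lemma tailMinorant_sub_le {k q : ℕ} (hk : 1 ≤ k) (hq : 1 ≤ q) :
    tailMinorant k q - tailMinorant k (q + 2) ≤ ratTerm k q - ratTerm k (q + 1) := by
  have hq' : (1 : ℝ) ≤ q := by exact_mod_cast hq
  have hk' : (1 : ℝ) ≤ k := by exact_mod_cast hk
  unfold tailMinorant ratTerm
  push_cast
  generalize (q : ℝ) = x at *
  have hK : (0 : ℝ) < (k : ℝ) ^ 2 := by positivity
  generalize (k : ℝ) ^ 2 = K at *
  have h1 : 0 < x ^ 2 - x + K := by nlinarith
  have h2 : 0 < (x + 2) ^ 2 - (x + 2) + K := by nlinarith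
  have h3 : 0 < x ^ 2 + K := by positivity
  have h4 : 0 < (x + 1) ^ 2 + K := by positivity
  have key : x / (x ^ 2 + K) - (x + 1) / ((x + 1) ^ 2 + K) -
      ((x - 1) / (2 * (x ^ 2 - x + K)) - (x + 2 - 1) / (2 * ((x + 2) ^ 2 - (x + 2) + K))) =
      ((x + 1) * (x ^ 2 + K) * ((x + 1) ^ 2 + K) + (x ^ 2 + x - K) * (K - 2 * x ^ 2 - 2 * x)) /
        ((x ^ 2 - x + K) * ((x + 2) ^ 2 - (x + 2) + K) * (x ^ 2 + K) * ((x + 1) ^ 2 + K)) := by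
    rw [div_sub_div _ _ h3.ne' h4.ne', div_sub_div _ _ (by positivity) (by positivity),
      div_sub_div _ _ (by positivity) (by positivity),
      div_eq_div_iff (by positivity) (by positivity)]
    ring
  rw [← sub_nonneg, key]
  refine div_nonneg ?_ (by positivity)
  have h5 : 0 ≤ x - 1 := by linarith
  have e : 0 ≤ (x + 1) ^ 2 * x ^ 2 * (x - 1) +
      K * ((x + 1) * (2 * x ^ 2 + 2 * x + 1) + 3 * (x ^ 2 + x)) + K ^ 2 * x := by positivity
  nlinarith [e]

/-- The alternating tail `∑_{n ≥ q} (-1)^(n-q) n/(n² + k²)` is nonnegative; the tails are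
characterised by their recursion and their limit. -/
lemma alternating_tail_nonneg {k : ℕ} (hk : 1 ≤ k) {T : ℕ → ℝ}
    (hT : ∀ q, T q = ratTerm k q - T (q + 1)) (h0 : Tendsto T atTop (nhds 0))
    {q : ℕ} (hq : 1 ≤ q) : 0 ≤ T q := by
  have step : ∀ n, T (q + 2 * n) - tailMinorant k (q + 2 * n) ≤ T q - tailMinorant k q := by
    intro n
    induction n with
    | zero => simp
    | succ n ih =>
      have h := tailMinorant_sub_le hk (show 1 ≤ q + 2 * n by omega)
      have h1 := hT (q + 2 * n)
      have h2 := hT (q + 2 * n + 1)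
      rw [show q + 2 * (n + 1) = q + 2 * n + 2 by ring]
      linarith
  have hlim : Tendsto (fun n => T (q + 2 * n) - tailMinorant k (q + 2 * n)) atTop (nhds 0) := by
    have hn : Tendsto (fun n : ℕ => q + 2 * n) atTop atTop :=
      tendsto_atTop_mono (fun n => by rw [id_eq]; omega) tendsto_id
    simpa using (h0.comp hn).sub ((tendsto_tailMinorant k).comp hn)
  have := le_of_tendsto' hlim step
  linarith [tailMinorant_nonneg k hq]

lemma abs_alternating_tail_le {k : ℕ} (hk : 1 ≤ k) {T : ℕ → ℝ}
    (hT : ∀ q, T q = ratTerm k q - T (q + 1)) (h0 : Tendsto T atTop (nhds 0))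
    {q : ℕ} (hq : 1 ≤ q) : |T q| ≤ ratTerm k q := by
  rw [abs_of_nonneg (alternating_tail_nonneg hk hT h0 hq), hT q]
  linarith [alternating_tail_nonneg hk hT h0 (show 1 ≤ q + 1 by omega)]

lemma abs_sub_partial_sum_le {k : ℕ} (hk : 1 ≤ k) {l : ℝ}
    (hl : Tendsto (fun N => ∑ n ∈ Finset.range N, (-1 : ℝ) ^ n * ratTerm k n) atTop (nhds l))
    {q : ℕ} (hq : 1 ≤ q) :
    |l - ∑ n ∈ Finset.range q, (-1 : ℝ) ^ n * ratTerm k n| ≤ ratTerm k q := by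
  have habs : ∀ (j : ℕ) (x : ℝ), |(-1) ^ j * x| = |x| := by simp [abs_mul]
  rw [← habs q]
  refine abs_alternating_tail_le hk
    (T := fun j => (-1) ^ j * (l - ∑ n ∈ Finset.range j, (-1 : ℝ) ^ n * ratTerm k n))
    (fun j => ?_) ?_ hq
  · have h : ((-1 : ℝ) ^ j) * (-1) ^ j = 1 := by rw [← mul_pow]; simp
    rw [Finset.sum_range_succ, pow_succ]
    linear_combination ratTerm k j * h
  · rw [tendsto_zero_iff_abs_tendsto_zero]
    have := (hl.const_sub l).abs
    simpa [Function.comp_def, abs_mul] using this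

/-- For `q, k ≥ 1` let `R_q(k) = ((-1)^k/k) ∑_{n ≥ q} (-1)ⁿ n/(n² + k²)` (the tail series
converging as a limit of partial sums). Then `|R_q(k)| ≤ (1/k) · q/(k² + q²)`, and
`ε_q = ∑_{k ≥ 1} R_q(k)` tends to `0` as `q → ∞`. -/
theorem tail_estimate_eps_tendsto_zero :
    ∃ R : ℕ → ℕ → ℝ,
      (∀ q k : ℕ, 1 ≤ q → 1 ≤ k →
        Tendsto
          (fun N : ℕ => ((-1 : ℝ) ^ k / (k : ℝ)) *
            ∑ n ∈ Finset.Ico q N, (-1 : ℝ) ^ n * (n : ℝ) / ((n : ℝ) ^ 2 + (k : ℝ) ^ 2))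
          atTop (nhds (R q k))) ∧
      (∀ q k : ℕ, 1 ≤ q → 1 ≤ k →
        |R q k| ≤ (1 / (k : ℝ)) * ((q : ℝ) / ((k : ℝ) ^ 2 + (q : ℝ) ^ 2))) ∧
      Tendsto (fun q : ℕ => ∑' k : ℕ, R q (k + 1)) atTop (nhds 0) := by
  have hex : ∀ k : ℕ, ∃ l, 1 ≤ k →
      Tendsto (fun N => ∑ n ∈ Finset.range N, (-1 : ℝ) ^ n * ratTerm k n) atTop (nhds l) := by
    intro k
    by_cases hk : 1 ≤ k
    · obtain ⟨l, hl⟩ := exists_tendsto_alternating_of_antitone_shift k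
        (antitone_ratTerm_shift hk) (tendsto_ratTerm k)
      exact ⟨l, fun _ => hl⟩
    · exact ⟨0, fun h => absurd h hk⟩
  choose l hl using hex
  let R : ℕ → ℕ → ℝ := fun q k =>
    (-1 : ℝ) ^ k / (k : ℝ) * (l k - ∑ n ∈ Finset.range q, (-1 : ℝ) ^ n * ratTerm k n)
  have hR : ∀ q k : ℕ, 1 ≤ q → 1 ≤ k → |R q k| ≤ 1 / (k : ℝ) * ratTerm k q := by
    intro q k hq hk
    have h : |(-1 : ℝ) ^ k / (k : ℝ)| = 1 / (k : ℝ) := by simp [abs_div]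
    simp only [R]
    rw [abs_mul, h]
    exact mul_le_mul_of_nonneg_left (abs_sub_partial_sum_le hk (hl k hk) hq) (by positivity)
  refine ⟨R, fun q k _ hk => ?_, fun q k hq hk => ?_, ?_⟩
  · refine (((hl k hk).sub_const _).const_mul _).congr' ?_
    filter_upwards [eventually_ge_atTop q] with N hN
    simp only [mul_div_assoc]
    rw [Finset.sum_Ico_eq_sub _ hN]
    rfl
  · simpa only [ratTerm, add_comm] using hR q k hq hk
  · have hsum : Summable fun k : ℕ => 1 / ((k + 1 : ℕ) : ℝ) ^ 2 :=
      (summable_nat_add_iff 1).2 (Real.summable_one_div_nat_pow.2 one_lt_two)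
    have hdom := tendsto_tsum_of_dominated_convergence (𝓕 := atTop)
      (f := fun q k => R q (k + 1)) (g := fun _ => (0 : ℝ)) hsum (fun k => ?_) ?_
    · simpa using hdom
    · rw [tendsto_zero_iff_abs_tendsto_zero]
      refine squeeze_zero' (Eventually.of_forall fun q => abs_nonneg _)
        (eventually_atTop.2 ⟨1, fun q hq => hR q (k + 1) hq (by omega)⟩) ?_
      simpa using (tendsto_ratTerm (k + 1)).const_mul (1 / ((k + 1 : ℕ) : ℝ))
    · filter_upwards [eventually_ge_atTop 1] with q hq k
      refine (hR q (k + 1) hq (by omega)).trans ?_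
      calc 1 / ((k + 1 : ℕ) : ℝ) * ratTerm (k + 1) q
          ≤ 1 / ((k + 1 : ℕ) : ℝ) * (1 / ((k + 1 : ℕ) : ℝ)) :=
            mul_le_mul_of_nonneg_left (ratTerm_le_one_div_left (by omega) q) (by positivity)
        _ = 1 / ((k + 1 : ℕ) : ℝ) ^ 2 := by ring
end
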